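/- Let P ⊂ ℝ^d be a lattice polytope of dimension d that is not a simplex, with 2 ≤ Vol(P) ≤ 4, such that ℤ((P,1) ∩ ℤ^{d+1}) ≠ ℤ^{d+1} and P is not a lattice pyramid. Then there exists an integer k ≥ 2 such that P is unimodularly equivalent to exactly one of the following four polytopes: A^(4)_1 = conv{0, e_1, …, e_{d−1}, Σ_{j=1}^{d−2} e_j + 2e_d, e_1 − e_{d−1}} with d = 2k and δ(P,t) = 1 + t + t^k + t^{k+1}; A^(4)_2 = conv{0, e_1, …, e_{d−1}, Σ_{j=1}^{d−3} e_j + 2e_d, e_{d−2} + e_{d−1}} with d = 2k+1 and δ(P,t) = 1 + t + t^k + t^{k+1}; A^(4)_3 = conv{0, e_1, …, e_{d−1}, Σ_{j=1}^{d−4} e_j + 2e_d, −e_{d−3} + e_{d−2} + e_{d−1}} with d = 2k+2 and δ(P,t) = 1 + t + t^k + t^{k+1}; B^(4) = conv{0, e_1, …, e_{d−1}, Σ_{j=1}^{d−2} e_j + 2e_d, −e_1 + e_{d−1}} with d = 2k and δ(P,t) = 1 + t + 2t^k. -/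

import Mathlib

open Pointwise Polynomial

noncomputable section

/-- The set of lattice points of `ℝ^d` (points with integer coordinates). -/
def latticePts (d : ℕ) : Set (Fin d → ℝ) := {x | ∀ i, ∃ z : ℤ, x i = (z : ℝ)}

/-- A lattice polytope: the convex hull of finitely many lattice points. -/
def IsLatticePolytope {d : ℕ} (P : Set (Fin d → ℝ)) : Prop :=
  ∃ V : Finset (Fin d → ℝ), (V : Set (Fin d → ℝ)) ⊆ latticePts d ∧
    P = convexHull ℝ (V : Set (Fin d → ℝ))

/-- `|nP ∩ ℤ^d|`. -/
def ehrhartCount {d : ℕ} (P : Set (Fin d → ℝ)) (n : ℕ) : ℕ :=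
  (latticePts d ∩ (n : ℝ) • P).ncard

/-- The Ehrhart series `1 + Σ_{n ≥ 1} |nP ∩ ℤ^d| tⁿ`. -/
def ehrhartSeries {d : ℕ} (P : Set (Fin d → ℝ)) : PowerSeries ℤ :=
  PowerSeries.mk fun n => if n = 0 then 1 else (ehrhartCount P n : ℤ)

/-- `p` is the δ-polynomial of the lattice polytope `P ⊆ ℝ^d` of dimension `d`,
i.e. `(1 - t)^(d+1) (1 + Σ_{n ≥ 1} |nP ∩ ℤ^d| tⁿ) = p`. -/
def HasDeltaPoly {d : ℕ} (P : Set (Fin d → ℝ)) (p : Polynomial ℤ) : Prop :=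
  (1 - PowerSeries.X) ^ (d + 1) * ehrhartSeries P = (p : PowerSeries ℤ)

/-- Unimodular equivalence: an affine map carrying `ℤ^d ∩ aff P` bijectively onto
`ℤ^e ∩ aff Q` and mapping `P` onto `Q`. -/
def UnimodEquiv {d e : ℕ} (P : Set (Fin d → ℝ)) (Q : Set (Fin e → ℝ)) : Prop :=
  ∃ f : (Fin d → ℝ) →ᵃ[ℝ] (Fin e → ℝ),
    Set.BijOn f (latticePts d ∩ (affineSpan ℝ P : Set (Fin d → ℝ)))
      (latticePts e ∩ (affineSpan ℝ Q : Set (Fin e → ℝ))) ∧ f '' P = Q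

/-- The lattice pyramid `Pyr(Q) = conv(Q × {0}, (0,…,0,1)) ⊆ ℝ^{e+1}`. -/
def pyramidOver {e : ℕ} (Q : Set (Fin e → ℝ)) : Set (Fin (e + 1) → ℝ) :=
  convexHull ℝ
    ((fun x : Fin e → ℝ => Fin.snoc x (0 : ℝ)) '' Q ∪ {Fin.snoc (0 : Fin e → ℝ) (1 : ℝ)})

/-- `P` is a lattice pyramid over some (full-dimensional) lattice polytope. -/
def IsLatticePyramid {d : ℕ} (P : Set (Fin d → ℝ)) : Prop :=
  ∃ (e : ℕ) (Q : Set (Fin e → ℝ)), IsLatticePolytope Q ∧ affineSpan ℝ Q = ⊤ ∧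
    UnimodEquiv P (pyramidOver Q)

/-- `P ⊆ ℝ^d` is a simplex (of some dimension). -/
def IsSimplex {d : ℕ} (P : Set (Fin d → ℝ)) : Prop :=
  ∃ (n : ℕ) (v : Fin (n + 1) → Fin d → ℝ), AffineIndependent ℝ v ∧
    P = convexHull ℝ (Set.range v)

/-- A full-dimensional lattice simplex of dimension `d` in `ℝ^d`. -/
def IsLatticeSimplexFD {d : ℕ} (Δ : Set (Fin d → ℝ)) : Prop :=
  ∃ v : Fin (d + 1) → Fin d → ℝ, AffineIndependent ℝ v ∧
    (∀ i, v i ∈ latticePts d) ∧ Δ = convexHull ℝ (Set.range v)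

/-- `ℤ((P,1) ∩ ℤ^{d+1}) = ℤ^{d+1}`: the lattice points of `P`, with last coordinate `1`
appended, generate all of `ℤ^{d+1}` as a group. -/
def SpansLattice {d : ℕ} (P : Set (Fin d → ℝ)) : Prop :=
  AddSubgroup.closure {y : Fin (d + 1) → ℤ |
    y (Fin.last d) = 1 ∧ (fun i : Fin d => (y i.castSucc : ℝ)) ∈ P} = ⊤

/-- The finite abelian group `Λ_Δ ⊆ (ℝ/ℤ)^{d+1}` attached to a lattice simplex with
ordered vertices `v 0, …, v d`, encoded by its canonical representatives in `[0,1)`. -/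
def simplexLambda {d : ℕ} (v : Fin (d + 1) → Fin d → ℝ) : Set (Fin (d + 1) → ℝ) :=
  {c | (∀ i, 0 ≤ c i ∧ c i < 1) ∧
    (∀ j : Fin d, ∃ z : ℤ, (∑ i, c i * v i j) = (z : ℝ)) ∧
    (∃ z : ℤ, (∑ i, c i) = (z : ℝ))}

/-- The standard basis vector `e_j` of `ℝ^d` (0-indexed). -/
def stdE (d : ℕ) (j : Fin d) : Fin d → ℝ := fun i => if i = j then 1 else 0

/-- `A⁽⁴⁾₁ = conv{0, e₁, …, e_{d−1}, Σ_{j=1}^{d−2} e_j + 2e_d, e₁ − e_{d−1}} ⊆ ℝ^d`. -/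
def polyA41 (d : ℕ) : Set (Fin d → ℝ) :=
  convexHull ℝ
    ({0,
      fun j : Fin d => if (j : ℕ) = d - 1 then (2 : ℝ) else if (j : ℕ) + 2 < d then 1 else 0,
      fun j : Fin d => if (j : ℕ) = 0 then (1 : ℝ) else if (j : ℕ) = d - 2 then -1 else 0} ∪
      {x | ∃ j : Fin d, (j : ℕ) < d - 1 ∧ x = stdE d j})

/-- `A⁽⁴⁾₂ = conv{0, e₁, …, e_{d−1}, Σ_{j=1}^{d−3} e_j + 2e_d, e_{d−2} + e_{d−1}} ⊆ ℝ^d`. -/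
def polyA42 (d : ℕ) : Set (Fin d → ℝ) :=
  convexHull ℝ
    ({0,
      fun j : Fin d => if (j : ℕ) = d - 1 then (2 : ℝ) else if (j : ℕ) + 3 < d then 1 else 0,
      fun j : Fin d => if (j : ℕ) = d - 3 ∨ (j : ℕ) = d - 2 then (1 : ℝ) else 0} ∪
      {x | ∃ j : Fin d, (j : ℕ) < d - 1 ∧ x = stdE d j})

/-- `A⁽⁴⁾₃ = conv{0, e₁, …, e_{d−1}, Σ_{j=1}^{d−4} e_j + 2e_d, −e_{d−3} + e_{d−2} + e_{d−1}} ⊆ ℝ^d`. -/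
def polyA43 (d : ℕ) : Set (Fin d → ℝ) :=
  convexHull ℝ
    ({0,
      fun j : Fin d => if (j : ℕ) = d - 1 then (2 : ℝ) else if (j : ℕ) + 4 < d then 1 else 0,
      fun j : Fin d =>
        if (j : ℕ) = d - 4 then (-1 : ℝ)
        else if (j : ℕ) = d - 3 ∨ (j : ℕ) = d - 2 then 1 else 0} ∪
      {x | ∃ j : Fin d, (j : ℕ) < d - 1 ∧ x = stdE d j})

/-- `B⁽⁴⁾ = conv{0, e₁, …, e_{d−1}, Σ_{j=1}^{d−2} e_j + 2e_d, −e₁ + e_{d−1}} ⊆ ℝ^d`. -/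
def polyB4 (d : ℕ) : Set (Fin d → ℝ) :=
  convexHull ℝ
    ({0,
      fun j : Fin d => if (j : ℕ) = d - 1 then (2 : ℝ) else if (j : ℕ) + 2 < d then 1 else 0,
      fun j : Fin d => if (j : ℕ) = 0 then (-1 : ℝ) else if (j : ℕ) = d - 2 then 1 else 0} ∪
      {x | ∃ j : Fin d, (j : ℕ) < d - 1 ∧ x = stdE d j})

/-- The integers, as a subring of the reals. -/
abbrev intSubring : Subring ℝ := (Int.castRingHom ℝ).range

theorem mem_intSubring {x : ℝ} : x ∈ intSubring ↔ ∃ z : ℤ, x = z := by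
  simp only [RingHom.mem_range, eq_intCast, eq_comm]

theorem intCast_mem_intSubring (z : ℤ) : (z : ℝ) ∈ intSubring := mem_intSubring.2 ⟨z, rfl⟩

theorem half_notMem_intSubring : (1 / 2 : ℝ) ∉ intSubring := by
  rintro h
  obtain ⟨z, hz⟩ := mem_intSubring.1 h
  have : (2 * z : ℝ) = 1 := by rw [← hz]; norm_num
  have : 2 * z = 1 := by exact_mod_cast this
  omega

theorem mem_latticePts {d : ℕ} {x : Fin d → ℝ} : x ∈ latticePts d ↔ ∀ i, x i ∈ intSubring := by
  simp only [latticePts, Set.mem_ofPred_eq, mem_intSubring]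

theorem Matrix.det_mem_intSubring {n : Type*} [Fintype n] [DecidableEq n] {M : Matrix n n ℝ}
    (h : ∀ i j, M i j ∈ intSubring) : M.det ∈ intSubring := by
  rw [Matrix.det_apply]
  refine sum_mem fun σ _ => ?_
  rw [Units.smul_def]
  exact zsmul_mem (prod_mem fun i _ => h _ _) _

theorem Matrix.mul_det_mem_intSubring {n : Type*} [Fintype n] [DecidableEq n] {M : Matrix n n ℝ}
    (h : ∀ i j, M i j ∈ intSubring) {c : n → ℝ} (hc : ∀ j, ∑ i, c i * M i j ∈ intSubring) (i : n) :
    c i * M.det ∈ intSubring := by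
  have := Matrix.det_updateRow_sum M i c
  rw [smul_eq_mul] at this
  rw [← this]
  refine Matrix.det_mem_intSubring fun k j => ?_
  by_cases hk : k = i
  · subst hk
    simpa [Matrix.updateRow_self, Finset.sum_apply] using hc j
  · simp only [Matrix.updateRow_ne hk, h k j]

/-- The homogenisation `(x, 1)` of a point `x`. -/
def homog {d : ℕ} (x : Fin d → ℝ) : Fin (d + 1) → ℝ := Fin.snoc (α := fun _ => ℝ) x 1

@[simp] theorem homog_castSucc {d : ℕ} (x : Fin d → ℝ) (j : Fin d) : homog x j.castSucc = x j := by
  simp [homog]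

@[simp] theorem homog_last {d : ℕ} (x : Fin d → ℝ) : homog x (Fin.last d) = 1 := by
  simp [homog]

theorem homog_mem_intSubring {d : ℕ} {x : Fin d → ℝ} (hx : x ∈ latticePts d) (j : Fin (d + 1)) :
    homog x j ∈ intSubring := by
  refine Fin.lastCases ?_ (fun j => ?_) j
  · simp
  · simpa using mem_latticePts.1 hx j

/-- The matrix whose rows are the homogenised points. -/
def homMat {d : ℕ} (v : Fin (d + 1) → Fin d → ℝ) : Matrix (Fin (d + 1)) (Fin (d + 1)) ℝ :=
  Matrix.of fun i => homog (v i)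

theorem homMat_apply {d : ℕ} (v : Fin (d + 1) → Fin d → ℝ) (i j : Fin (d + 1)) :
    homMat v i j = homog (v i) j := rfl

theorem homMat_mem_intSubring {d : ℕ} {v : Fin (d + 1) → Fin d → ℝ}
    (hv : ∀ i, v i ∈ latticePts d) (i j : Fin (d + 1)) : homMat v i j ∈ intSubring :=
  homog_mem_intSubring (hv i) j

theorem homMat_update {d : ℕ} (v : Fin (d + 1) → Fin d → ℝ) (i : Fin (d + 1)) (u : Fin d → ℝ) :
    homMat (Function.update v i u) = (homMat v).updateRow i (homog u) := by
  ext k j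
  by_cases hk : k = i
  · subst hk; simp [homMat_apply]
  · simp [homMat_apply, hk]

/-- `c` are barycentric coordinates of `x` with respect to `v`. -/
def IsBary {ι : Type*} [Fintype ι] {d : ℕ} (v : ι → Fin d → ℝ) (x : Fin d → ℝ) (c : ι → ℝ) : Prop :=
  ∑ i, c i = 1 ∧ ∀ j, ∑ i, c i * v i j = x j

theorem isBary_iff_homog {ι : Type*} [Fintype ι] {d : ℕ} {v : ι → Fin d → ℝ} {x : Fin d → ℝ}
    {c : ι → ℝ} : IsBary v x c ↔ ∀ j, ∑ i, c i * homog (v i) j = homog x j := by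
  rw [Fin.forall_fin_succ']
  simp [IsBary, and_comm]

theorem IsBary.det_update {d : ℕ} {v : Fin (d + 1) → Fin d → ℝ} {x : Fin d → ℝ}
    {c : Fin (d + 1) → ℝ} (h : IsBary v x c) (i : Fin (d + 1)) :
    (homMat (Function.update v i x)).det = c i * (homMat v).det := by
  rw [homMat_update, ← smul_eq_mul, ← Matrix.det_updateRow_sum (homMat v) i c]
  congr 2
  ext j
  rw [← isBary_iff_homog.1 h j]
  simp [homMat_apply]

theorem spansLattice_of_forall {d : ℕ} {P : Set (Fin d → ℝ)} {ι : Type*} [Fintype ι]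
    (w : ι → Fin d → ℝ) (hw : ∀ i, w i ∈ latticePts d) (hwP : ∀ i, w i ∈ P)
    (h : ∀ y : Fin (d + 1) → ℝ, (∀ j, y j ∈ intSubring) →
      ∃ c : ι → ℝ, (∀ i, c i ∈ intSubring) ∧ ∀ j, ∑ i, c i * homog (w i) j = y j) :
    SpansLattice P := by
  rw [SpansLattice, eq_top_iff]
  intro y _
  obtain ⟨c, hc, hcy⟩ := h (fun j => y j) fun j => intCast_mem_intSubring _
  choose b hb using fun i => mem_intSubring.1 (hc i)
  choose W hW using fun i j => mem_intSubring.1 (homog_mem_intSubring (hw i) j)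
  have : y = ∑ i, b i • W i := by
    ext j
    have := hcy j
    simp only [hb, hW] at this
    rw [Finset.sum_apply]
    simp only [Pi.smul_apply, smul_eq_mul]
    exact_mod_cast this.symm
  rw [this]
  refine sum_mem fun i _ => zsmul_mem (AddSubgroup.subset_closure ?_) _
  rw [Set.mem_ofPred_eq]
  refine ⟨?_, ?_⟩
  · have := hW i (Fin.last d)
    rw [homog_last] at this
    exact_mod_cast this.symm
  · convert hwP i using 1
    ext j
    rw [← hW i, homog_castSucc]

theorem exists_vecMul_eq {n : Type*} [Fintype n] [DecidableEq n] {M : Matrix n n ℝ}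
    (h : M.det ≠ 0) (y : n → ℝ) : ∃ c : n → ℝ, ∀ j, ∑ i, c i * M i j = y j := by
  refine ⟨Matrix.vecMul y M⁻¹, fun j => ?_⟩
  have : Matrix.vecMul (Matrix.vecMul y M⁻¹) M = y := by
    rw [Matrix.vecMul_vecMul, Matrix.nonsing_inv_mul _ (isUnit_iff_ne_zero.2 h), Matrix.vecMul_one]
  exact congrFun this j

theorem eq_of_vecMul_eq {n : Type*} [Fintype n] [DecidableEq n] {M : Matrix n n ℝ}
    (h : M.det ≠ 0) {c c' : n → ℝ} (hc : ∀ j, ∑ i, c i * M i j = ∑ i, c' i * M i j) : c = c' := by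
  have := Matrix.vecMul_injective_of_isUnit ((Matrix.isUnit_iff_isUnit_det M).2 (isUnit_iff_ne_zero.2 h))
  exact this (funext hc)

theorem spansLattice_of_abs_det_eq_one {d : ℕ} {P : Set (Fin d → ℝ)}
    {v : Fin (d + 1) → Fin d → ℝ} (hv : ∀ i, v i ∈ latticePts d) (hvP : ∀ i, v i ∈ P)
    (h : |(homMat v).det| = 1) : SpansLattice P := by
  refine spansLattice_of_forall v hv hvP fun y hy => ?_
  have h0 : (homMat v).det ≠ 0 := by intro h0; simp [h0] at h
  obtain ⟨c, hc⟩ := exists_vecMul_eq h0 y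
  refine ⟨c, fun i => ?_, hc⟩
  have := Matrix.mul_det_mem_intSubring (homMat_mem_intSubring hv) (c := c)
    (fun j => by rw [hc]; exact hy j) i
  rcases eq_or_eq_neg_of_abs_eq h with h1 | h1 <;> rw [h1] at this
  · simpa using this
  · simpa using neg_mem this

theorem two_le_abs_det {d : ℕ} {P : Set (Fin d → ℝ)} (hP : ¬ SpansLattice P)
    {v : Fin (d + 1) → Fin d → ℝ} (hv : ∀ i, v i ∈ latticePts d) (hvP : ∀ i, v i ∈ P)
    (h : (homMat v).det ≠ 0) : 2 ≤ |(homMat v).det| := by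
  obtain ⟨z, hz⟩ := mem_intSubring.1 (Matrix.det_mem_intSubring (homMat_mem_intSubring hv))
  have h1 : |(homMat v).det| ≠ 1 := fun h1 => hP (spansLattice_of_abs_det_eq_one hv hvP h1)
  rw [hz] at h h1 ⊢
  norm_cast at h h1 ⊢
  have : 0 < |z| := abs_pos.2 h
  omega

theorem mem_convexHull_range {ι : Type*} [Fintype ι] {d : ℕ} {w : ι → Fin d → ℝ} {x : Fin d → ℝ} :
    x ∈ convexHull ℝ (Set.range w) ↔ ∃ c : ι → ℝ, (∀ i, 0 ≤ c i) ∧ IsBary w x c := by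
  classical
  have : Set.range w = Fintype.linearCombination ℝ w '' Set.range fun i : ι => Pi.single i (1 : ℝ) := by
    rw [← Set.range_comp]
    congr 1
    ext i j
    simp [Fintype.linearCombination_apply_single]
  rw [this, ← LinearMap.image_convexHull, convexHull_rangle_single_eq_stdSimplex]
  constructor
  · rintro ⟨c, ⟨h0, h1⟩, rfl⟩
    exact ⟨c, h0, h1, fun j => by simp [Fintype.linearCombination_apply, Finset.sum_apply]⟩
  · rintro ⟨c, h0, h1, h2⟩
    refine ⟨c, ⟨h0, h1⟩, ?_⟩
    ext j
    simp [Fintype.linearCombination_apply, Finset.sum_apply, h2]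

theorem mem_smul_convexHull_range {ι : Type*} [Fintype ι] {d : ℕ} {w : ι → Fin d → ℝ}
    {x : Fin d → ℝ} {r : ℝ} (hr : 0 < r) :
    x ∈ r • convexHull ℝ (Set.range w) ↔
      ∃ c : ι → ℝ, (∀ i, 0 ≤ c i) ∧ ∑ i, c i = r ∧ ∀ j, ∑ i, c i * w i j = x j := by
  rw [Set.mem_smul_set_iff_inv_smul_mem₀ hr.ne', mem_convexHull_range]
  constructor
  · rintro ⟨c, h0, h1, h2⟩
    refine ⟨fun i => r * c i, fun i => mul_nonneg hr.le (h0 i), by rw [← Finset.mul_sum, h1, mul_one],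
      fun j => ?_⟩
    simp_rw [mul_assoc]
    rw [← Finset.mul_sum, h2]
    simp [hr.ne']
  · rintro ⟨c, h0, h1, h2⟩
    refine ⟨fun i => r⁻¹ * c i, fun i => mul_nonneg (inv_nonneg.2 hr.le) (h0 i),
      by rw [← Finset.mul_sum, h1, inv_mul_cancel₀ hr.ne'], fun j => ?_⟩
    simp_rw [mul_assoc]
    rw [← Finset.mul_sum, h2]
    simp

/-- The vertices `e_1, …, e_d, 0` of the standard simplex. -/
def stdVert (d : ℕ) : Fin (d + 1) → Fin d → ℝ :=
  Fin.snoc (α := fun _ => Fin d → ℝ) (fun i => Pi.single i 1) 0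

theorem det_homMat_eq {d : ℕ} (v : Fin (d + 1) → Fin d → ℝ) :
    (homMat v).det =
      (Matrix.of fun i j : Fin d => v i.castSucc j - v (Fin.last d) j).det := by
  let B : Matrix (Fin (d + 1)) (Fin (d + 1)) ℝ := Matrix.of fun i =>
    if i = Fin.last d then homog (v i) else homog (v i) - homog (v (Fin.last d))
  rw [Matrix.det_eq_of_forall_row_eq_smul_add_const (B := B)
    (fun i => if i = Fin.last d then 0 else 1) (Fin.last d) (by simp)]
  · rw [Matrix.det_succ_column _ (Fin.last d), Fin.sum_univ_castSucc, Finset.sum_eq_zero]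
    · simp only [B, Matrix.of_apply, zero_add, if_true, homog_last, Fin.val_last]
      rw [← two_mul, pow_mul]
      simp only [even_two, Even.neg_pow, one_pow, mul_one, one_mul]
      congr 1
      ext i j
      simp [Fin.succAbove_last, Fin.castSucc_ne_last]
    · intro i _
      simp [B, Fin.castSucc_ne_last]
  · intro i j
    by_cases hi : i = Fin.last d
    · simp [B, hi, homMat_apply]
    · simp [B, hi, homMat_apply]

open MeasureTheory in
theorem volume_simplex {d : ℕ} (v : Fin (d + 1) → Fin d → ℝ) :
    volume (convexHull ℝ (Set.range v)) =
      ENNReal.ofReal |(homMat v).det| * volume (convexHull ℝ (Set.range (stdVert d))) := by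
  let N : Matrix (Fin d) (Fin d) ℝ := Matrix.of fun i j : Fin d => v i.castSucc j - v (Fin.last d) j
  have hv : Set.range v = (fun x => v (Fin.last d) + x) ''
      (Matrix.toLin' N.transpose '' Set.range (stdVert d)) := by
    rw [← Set.range_comp, ← Set.range_comp]
    congr 1
    ext i j
    refine Fin.lastCases ?_ (fun i => ?_) i
    · simp [stdVert]
    · simp [stdVert, N]
  have himg : convexHull ℝ (Set.range v) = (fun x => v (Fin.last d) + x) ''
      (Matrix.toLin' N.transpose '' convexHull ℝ (Set.range (stdVert d))) := by
    rw [hv, LinearMap.image_convexHull]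
    have := AffineMap.image_convexHull (𝕜 := ℝ) (AffineMap.const ℝ (Fin d → ℝ) (v (Fin.last d)) +
      AffineMap.id ℝ (Fin d → ℝ)) (Matrix.toLin' N.transpose '' Set.range (stdVert d))
    exact this.symm
  rw [himg, Set.image_add_left, measure_preimage_add, Measure.addHaar_image_linearMap,
    LinearMap.det_toLin', Matrix.det_transpose, det_homMat_eq]

theorem hasDeltaPoly_iff {d : ℕ} {P : Set (Fin d → ℝ)} {p : Polynomial ℤ} :
    HasDeltaPoly P p ↔
      ehrhartSeries P = (p : PowerSeries ℤ) * PowerSeries.mk fun n => ((d + n).choose d : ℤ) := by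
  have h : (1 - PowerSeries.X : PowerSeries ℤ) ^ (d + 1) *
      (PowerSeries.mk fun n => ((d + n).choose d : ℤ)) = 1 := by
    rw [← PowerSeries.mk_one_pow_eq_mk_choose_add, ← mul_pow, mul_comm,
      PowerSeries.mk_one_mul_one_sub_eq_one, one_pow]
  rw [HasDeltaPoly]
  constructor
  · intro hp
    rw [← hp, mul_right_comm, h, one_mul]
  · intro hp
    rw [hp, mul_left_comm, h, mul_one]

open Filter Topology in
theorem tendsto_choose_div_pow (d i : ℕ) :
    Tendsto (fun n : ℕ => ((d + (n - i)).choose d : ℝ) / (n : ℝ) ^ d) atTop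
      (𝓝 ((d.factorial : ℝ)⁻¹)) := by
  have h1 : Tendsto (fun n : ℕ => (d.factorial : ℝ)⁻¹ *
      ∏ j ∈ Finset.range d, (1 + ((1 + j : ℝ) - i) / (n : ℝ))) atTop
      (𝓝 ((d.factorial : ℝ)⁻¹ * ∏ j ∈ Finset.range d, (1 + 0))) := by
    refine Tendsto.const_mul _ (tendsto_finsetProd _ fun j _ => Tendsto.const_add _ ?_)
    exact tendsto_const_div_atTop_nhds_zero_nat _
  simp only [add_zero, Finset.prod_const_one, mul_one] at h1
  refine h1.congr' ?_
  filter_upwards [eventually_ge_atTop (i + 1)] with n hn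
  have hn0 : (n : ℝ) ≠ 0 := by
    rw [Nat.cast_ne_zero]
    omega
  have h2 := Nat.ascFactorial_eq_factorial_mul_choose (n - i) d
  rw [Nat.ascFactorial_eq_prod_range, add_comm (n - i) d] at h2
  have h3 : ((d + (n - i)).choose d : ℝ) = (d.factorial : ℝ)⁻¹ *
      ∏ j ∈ Finset.range d, ((n : ℝ) - i + 1 + j) := by
    have h4 : (d.factorial : ℝ) ≠ 0 := by positivity
    have := congrArg (Nat.cast : ℕ → ℝ) h2
    push_cast [Nat.cast_sub (show i ≤ n by omega)] at this
    rw [this, inv_mul_cancel_left₀ h4]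
  rw [h3, mul_div_assoc]
  congr 1
  rw [← Finset.card_range d, ← Finset.prod_const, Finset.card_range, ← Finset.prod_div_distrib]
  refine Finset.prod_congr rfl fun j _ => ?_
  field_simp
  ring

open Filter Topology in
theorem tendsto_coeff_div_pow (d : ℕ) (p : Polynomial ℤ) :
    Tendsto (fun n : ℕ => ((PowerSeries.coeff n ((p : PowerSeries ℤ) *
      PowerSeries.mk fun n => ((d + n).choose d : ℤ)) : ℤ) : ℝ) / (n : ℝ) ^ d) atTop
      (𝓝 ((p.eval 1 : ℤ) * (d.factorial : ℝ)⁻¹)) := by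
  induction p using Polynomial.induction_on' with
  | add p q hp hq =>
    simp only [Polynomial.coe_add, add_mul, map_add, Int.cast_add, add_div, Polynomial.eval_add]
    exact hp.add hq
  | monomial i a =>
    simp only [Polynomial.eval_monomial, one_pow, mul_one]
    refine ((tendsto_choose_div_pow d i).const_mul (a : ℝ)).congr' ?_
    filter_upwards [eventually_ge_atTop i] with n hn
    rw [← Polynomial.C_mul_X_pow_eq_monomial, Polynomial.coe_mul, Polynomial.coe_C,
      Polynomial.coe_pow, Polynomial.coe_X, mul_assoc, PowerSeries.coeff_C_mul,
      PowerSeries.coeff_X_pow_mul', if_pos hn, PowerSeries.coeff_mk, ← mul_div_assoc]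
    push_cast
    rfl

open Filter Topology MeasureTheory in
theorem eval_one_eq_volume {d : ℕ} {P : Set (Fin d → ℝ)} {p : Polynomial ℤ}
    (hp : HasDeltaPoly P p) (hc : IsCompact P) (hconv : Convex ℝ P) :
    ((p.eval 1 : ℤ) : ℝ) * (d.factorial : ℝ)⁻¹ = volume.real P := by
  have h1 := tendsto_coeff_div_pow d p
  rw [← hasDeltaPoly_iff.1 hp] at h1
  have h2 := tendsto_card_div_pow_atTop_volume P hc.isBounded hc.measurableSet
    (hconv.addHaar_frontier volume)
  refine tendsto_nhds_unique h1 (h2.congr' ?_)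
  filter_upwards [eventually_ge_atTop 1] with n hn
  have hn0 : (n : ℝ) ≠ 0 := by
    rw [Nat.cast_ne_zero]
    omega
  rw [Fintype.card_fin, ehrhartSeries, PowerSeries.coeff_mk, if_neg (by omega), ehrhartCount]
  congr 1
  rw [← Nat.card_coe_set_eq]
  push_cast
  congr 1
  refine Nat.card_congr (Equiv.subtypeEquiv (Equiv.smulRight (a := (n : ℝ)) hn0) fun x => ?_)
  rw [Set.mem_inter_iff, Set.mem_inter_iff, and_comm, Set.mem_smul_set_iff_inv_smul_mem₀
    (inv_ne_zero hn0), inv_inv, SetLike.mem_coe, Module.Basis.mem_span_iff_repr_mem]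
  refine and_congr ?_ ?_
  · simp only [mem_latticePts, Set.mem_range, mem_intSubring, Pi.basisFun_repr]
    simp [eq_comm]
  · exact (Set.smul_mem_smul_set_iff₀ hn0 P x).symm

theorem ncard_sum_eq (d n : ℕ) :
    {b : Fin (d + 1) → ℕ | ∑ i, b i = n}.ncard = (d + n).choose d := by
  have : {b : Fin (d + 1) → ℕ | ∑ i, b i = n} =
      (Finsupp.equivFunOnFinite : (Fin (d + 1) →₀ ℕ) ≃ (Fin (d + 1) → ℕ)) ''
        (Finset.finsuppAntidiag (Finset.univ : Finset (Fin (d + 1))) n : Set (Fin (d + 1) →₀ ℕ)) := by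
    ext b
    simp only [Set.mem_ofPred_eq, Set.mem_image, SetLike.mem_coe, Finset.mem_finsuppAntidiag,
      Finset.subset_univ, and_true]
    constructor
    · intro h
      exact ⟨Finsupp.equivFunOnFinite.symm b, by simpa using h, by simp⟩
    · rintro ⟨f, hf, rfl⟩
      simpa using hf
  rw [this, Set.ncard_image_of_injective _ (Equiv.injective _), Set.ncard_coe_finset,
    Finset.card_finsuppAntidiag_nat_eq_choose, Finset.card_univ, Fintype.card_fin]
  rw [show d + 1 + n - 1 = d + n by omega, Nat.choose_symm_add]

/-- The points `s + β` with `β` a vector of natural numbers of sum `n - m`. -/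
def shiftedPts {d : ℕ} (s : Fin (d + 1) → ℝ) (m n : ℕ) : Set (Fin (d + 1) → ℝ) :=
  (fun (b : Fin (d + 1) → ℕ) i => s i + b i) '' {b | m + ∑ i, b i = n}

theorem sum_of_mem_shiftedPts {d : ℕ} {s : Fin (d + 1) → ℝ} {m n : ℕ} (hs : ∑ i, s i = m)
    {x : Fin (d + 1) → ℝ} (hx : x ∈ shiftedPts s m n) : ∑ i, x i = n := by
  obtain ⟨b, hb, rfl⟩ := hx
  rw [Set.mem_ofPred_eq] at hb
  rw [Finset.sum_add_distrib, hs, ← hb]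
  push_cast
  rfl

theorem finite_shiftedPts {d : ℕ} (s : Fin (d + 1) → ℝ) (m n : ℕ) : (shiftedPts s m n).Finite := by
  refine Set.Finite.image _ ((Set.finite_Iic (fun _ => n : Fin (d + 1) → ℕ)).subset fun b hb i => ?_)
  rw [Set.mem_ofPred_eq] at hb
  have := Finset.single_le_sum (f := b) (fun _ _ => Nat.zero_le _) (Finset.mem_univ i)
  show b i ≤ n
  omega

theorem ncard_shiftedPts {d : ℕ} (s : Fin (d + 1) → ℝ) (m n : ℕ) :
    ((shiftedPts s m n).ncard : ℤ) = PowerSeries.coeff n ((PowerSeries.X : PowerSeries ℤ) ^ m *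
      PowerSeries.mk fun n => ((d + n).choose d : ℤ)) := by
  rw [shiftedPts, Set.ncard_image_of_injective, PowerSeries.coeff_X_pow_mul']
  · split_ifs with h
    · rw [PowerSeries.coeff_mk, ← ncard_sum_eq]
      congr 2
      ext b
      simp only [Set.mem_ofPred_eq]
      omega
    · rw [Nat.cast_eq_zero, Set.ncard_eq_zero ?_]
      · ext b
        simp only [Set.mem_ofPred_eq, Set.mem_empty_iff_false, iff_false]
        omega
      · refine (Set.finite_empty).subset fun b hb => ?_
        rw [Set.mem_ofPred_eq] at hb
        omega
  · intro b b' h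
    ext i
    have := congrFun h i
    simpa using this

theorem natCast_of_mem_intSubring {x : ℝ} (h : x ∈ intSubring) (h0 : 0 ≤ x) : ∃ n : ℕ, x = n := by
  obtain ⟨z, rfl⟩ := mem_intSubring.1 h
  lift z to ℕ using by exact_mod_cast h0
  exact ⟨z, by simp⟩

theorem hasDeltaPoly_stdVert (d : ℕ) : HasDeltaPoly (convexHull ℝ (Set.range (stdVert d))) 1 := by
  rw [hasDeltaPoly_iff, Polynomial.coe_one, one_mul]
  ext n
  rw [ehrhartSeries, PowerSeries.coeff_mk, PowerSeries.coeff_mk]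
  split_ifs with hn
  · simp [hn]
  have hn' : (0 : ℝ) < n := by positivity
  rw [ehrhartCount, ← ncard_sum_eq]
  congr 1
  have hT : ∀ (c : Fin (d + 1) → ℝ) j, ∑ i, c i * stdVert d i j = c j.castSucc := by
    intro c j
    simp [Fin.sum_univ_castSucc, stdVert, Pi.single_apply]
  symm
  refine Set.ncard_congr (fun b _ j => (b j.castSucc : ℝ)) ?_ ?_ ?_
  · intro b hb
    refine ⟨fun j => ⟨b j.castSucc, by simp⟩, (mem_smul_convexHull_range hn').2
      ⟨fun i => b i, fun i => Nat.cast_nonneg _, ?_, fun j => hT _ _⟩⟩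
    rw [Set.mem_ofPred_eq] at hb
    show ∑ i, (b i : ℝ) = n
    exact_mod_cast hb
  · intro b b' hb hb' h
    rw [Set.mem_ofPred_eq, Fin.sum_univ_castSucc] at hb hb'
    have h1 : ∀ j : Fin d, b j.castSucc = b' j.castSucc := fun j => by exact_mod_cast congrFun h j
    simp only [h1] at hb
    ext i
    refine Fin.lastCases ?_ (fun i => ?_) i
    · omega
    · exact h1 i
  · rintro x ⟨hx, hxP⟩
    obtain ⟨c, h0, h1, h2⟩ := (mem_smul_convexHull_range hn').1 hxP
    simp only [hT] at h2
    have hZ : ∀ i, c i ∈ intSubring := by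
      have h3 : ∀ j : Fin d, c j.castSucc ∈ intSubring := fun j => by
        rw [h2]; exact mem_latticePts.1 hx j
      intro i
      refine Fin.lastCases ?_ h3 i
      rw [Fin.sum_univ_castSucc] at h1
      rw [eq_sub_iff_add_eq'.2 h1]
      exact sub_mem (natCast_mem _ n) (sum_mem fun i _ => h3 i)
    choose b hb using fun i => natCast_of_mem_intSubring (hZ i) (h0 i)
    refine ⟨b, ?_, ?_⟩
    · rw [Set.mem_ofPred_eq]
      simp only [hb] at h1
      exact_mod_cast h1
    · ext j
      rw [← h2, hb]

open MeasureTheory in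
theorem volume_stdVert (d : ℕ) :
    volume.real (convexHull ℝ (Set.range (stdVert d))) = (d.factorial : ℝ)⁻¹ := by
  rw [← eval_one_eq_volume (hasDeltaPoly_stdVert d) ((Set.finite_range _).isCompact_convexHull ℝ)
    (convex_convexHull ℝ _)]
  simp

open MeasureTheory in
/-- The normalised volumes of simplices in `P` with pairwise disjoint interiors add up to at most
the normalised volume of `P`. -/
theorem sum_abs_det_le {d : ℕ} {P : Set (Fin d → ℝ)} {p : Polynomial ℤ}
    (hp : HasDeltaPoly P p) (hc : IsCompact P) (hconv : Convex ℝ P) {ι : Type*} [Fintype ι]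
    (w : ι → Fin (d + 1) → Fin d → ℝ) (hw : ∀ i k, w i k ∈ P)
    (hsep : Pairwise fun i j => ∃ g : (Fin d → ℝ) →ᵃ[ℝ] ℝ, (∃ x, g x ≠ 0) ∧
      (∀ k, g (w i k) ≤ 0) ∧ ∀ k, 0 ≤ g (w j k)) :
    ∑ i, |(homMat (w i)).det| ≤ (p.eval 1 : ℤ) := by
  have hd : (0 : ℝ) < (d.factorial : ℝ)⁻¹ := by positivity
  refine le_of_mul_le_mul_right ?_ hd
  rw [eval_one_eq_volume hp hc hconv]
  have hsub : (⋃ i ∈ (Finset.univ : Finset ι), convexHull ℝ (Set.range (w i))) ⊆ P := by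
    refine Set.iUnion₂_subset fun i _ => convexHull_min ?_ hconv
    rintro _ ⟨k, rfl⟩
    exact hw i k
  have hfin : ∀ v : Fin (d + 1) → Fin d → ℝ, volume (convexHull ℝ (Set.range v)) ≠ ⊤ := fun v =>
    ((Set.finite_range v).isCompact_convexHull ℝ).measure_lt_top.ne
  have hmeas := measure_mono (μ := volume) hsub
  rw [measure_biUnion_finset₀] at hmeas
  · have h2 := (ENNReal.toReal_le_toReal (by simp [hfin]) hc.measure_lt_top.ne).2 hmeas
    rw [ENNReal.toReal_sum fun i _ => hfin _] at h2
    rw [Finset.sum_mul]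
    refine le_trans (le_of_eq (Finset.sum_congr rfl fun i _ => ?_)) h2
    rw [volume_simplex, ENNReal.toReal_mul, ENNReal.toReal_ofReal (abs_nonneg _), ← volume_stdVert]
    rfl
  · intro i _ j _ hij
    obtain ⟨g, ⟨x, hx⟩, h1, h2⟩ := hsep hij
    have h0 := Measure.addHaar_affineSubspace (volume : Measure (Fin d → ℝ))
      ((affineSpan ℝ {(0 : ℝ)}).comap g) (by
        intro h
        have : x ∈ (affineSpan ℝ {(0 : ℝ)}).comap g := h ▸ AffineSubspace.mem_top ℝ _ x
        rw [AffineSubspace.mem_comap, AffineSubspace.mem_affineSpan_singleton] at this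
        exact hx this)
    refine measure_mono_null ?_ h0
    rintro y ⟨hy1, hy2⟩
    have hle : y ∈ g ⁻¹' Set.Iic 0 := by
      refine convexHull_min ?_ ((convex_Iic (0 : ℝ)).affine_preimage g) hy1
      rintro _ ⟨k, rfl⟩
      exact h1 k
    have hge : y ∈ g ⁻¹' Set.Ici 0 := by
      refine convexHull_min ?_ ((convex_Ici (0 : ℝ)).affine_preimage g) hy2
      rintro _ ⟨k, rfl⟩
      exact h2 k
    rw [SetLike.mem_coe, AffineSubspace.mem_comap, AffineSubspace.mem_affineSpan_singleton]
    exact le_antisymm hle hge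
  · intro i _
    exact (convex_convexHull ℝ _).nullMeasurableSet _

/-- The affine map sending a point to its barycentric coordinates with respect to `v`. -/
def bary {d : ℕ} (v : Fin (d + 1) → Fin d → ℝ) : (Fin d → ℝ) →ᵃ[ℝ] (Fin (d + 1) → ℝ) where
  toFun x := Matrix.vecMul (homog x) (homMat v)⁻¹
  linear :=
    { toFun := fun y => Matrix.vecMul (Fin.snoc (α := fun _ => ℝ) y 0) (homMat v)⁻¹
      map_add' := fun x y => by
        rw [← Matrix.add_vecMul]
        congr 1
        ext i
        refine Fin.lastCases ?_ (fun i => ?_) i <;> simp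
      map_smul' := fun r x => by
        rw [RingHom.id_apply, ← Matrix.smul_vecMul]
        congr 1
        ext i
        refine Fin.lastCases ?_ (fun i => ?_) i <;> simp }
  map_vadd' x y := by
    rw [vadd_eq_add, vadd_eq_add]
    refine Eq.trans ?_ (Matrix.add_vecMul _ (Fin.snoc (α := fun _ => ℝ) y 0) (homog x))
    congr 1
    ext i
    refine Fin.lastCases ?_ (fun i => ?_) i <;> simp

section bary

variable {d : ℕ} {v : Fin (d + 1) → Fin d → ℝ}

theorem isBary_bary (h : (homMat v).det ≠ 0) (x : Fin d → ℝ) : IsBary v x (bary v x) := by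
  rw [isBary_iff_homog]
  intro j
  have : Matrix.vecMul (Matrix.vecMul (homog x) (homMat v)⁻¹) (homMat v) = homog x := by
    rw [Matrix.vecMul_vecMul, Matrix.nonsing_inv_mul _ (isUnit_iff_ne_zero.2 h), Matrix.vecMul_one]
  exact congrFun this j

theorem IsBary.bary_eq (h : (homMat v).det ≠ 0) {x : Fin d → ℝ} {c : Fin (d + 1) → ℝ}
    (hc : IsBary v x c) : bary v x = c := by
  refine eq_of_vecMul_eq h fun j => ?_
  simp only [homMat_apply]
  rw [isBary_iff_homog.1 hc, isBary_iff_homog.1 (isBary_bary h x)]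

theorem bary_self (h : (homMat v).det ≠ 0) (i : Fin (d + 1)) : bary v (v i) = Pi.single i 1 := by
  refine IsBary.bary_eq h ⟨by simp, fun j => ?_⟩
  simp [Pi.single_apply]

theorem eq_of_bary_eq (h : (homMat v).det ≠ 0) {x y : Fin d → ℝ} (hxy : bary v x = bary v y) :
    x = y := by
  ext j
  rw [← (isBary_bary h x).2, ← (isBary_bary h y).2, hxy]

theorem bary_circuit (h : (homMat v).det ≠ 0) (a b c : Fin (d + 1)) :
    bary v (v a + v b - v c) = Pi.single a 1 + Pi.single b 1 - Pi.single c 1 := by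
  refine IsBary.bary_eq h ⟨by simp [Finset.sum_add_distrib], fun j => ?_⟩
  simp [Pi.single_apply, sub_mul, add_mul, Finset.sum_add_distrib]

theorem affineIndependent_of_det_ne_zero (h : (homMat v).det ≠ 0) : AffineIndependent ℝ v := by
  rw [affineIndependent_iff]
  intro s w hw hwv i hi
  have : (fun i => if i ∈ s then w i else 0) = 0 := by
    refine eq_of_vecMul_eq h fun j => ?_
    simp only [Pi.zero_apply, zero_mul, Finset.sum_const_zero, ite_mul, Finset.sum_ite_mem,
      Finset.univ_inter, homMat_apply]
    refine Fin.lastCases ?_ (fun j => ?_) j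
    · simpa using hw
    · simpa [Finset.sum_apply] using congrFun hwv j
  simpa [hi] using congrFun this i

theorem det_ne_zero_of_affineIndependent (h : AffineIndependent ℝ v) : (homMat v).det ≠ 0 := by
  intro h0
  obtain ⟨w, hw0, hw⟩ := Matrix.exists_vecMul_eq_zero_iff.2 h0
  rw [affineIndependent_iff] at h
  have h1 : ∀ j, ∑ i, w i * homog (v i) j = 0 := fun j => congrFun hw j
  refine hw0 (funext fun i => h Finset.univ w ?_ ?_ i (Finset.mem_univ i))
  · simpa using h1 (Fin.last d)
  · ext j
    simpa [Finset.sum_apply] using h1 j.castSucc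

end bary

theorem exists_det_ne_zero {d : ℕ} {V : Set (Fin d → ℝ)} (hV : affineSpan ℝ V = ⊤) :
    ∃ v : Fin (d + 1) → Fin d → ℝ, (∀ i, v i ∈ V) ∧ (homMat v).det ≠ 0 := by
  obtain ⟨t, htV, hts, hti⟩ := exists_affineIndependent ℝ (Fin d → ℝ) V
  rw [hV] at hts
  have hfin : Finite t := finite_of_fin_dim_affineIndependent ℝ hti
  have := Fintype.ofFinite t
  have hcard := (hti.affineSpan_eq_top_iff_card_eq_finrank_add_one).1 (by simpa using hts)
  rw [Module.finrank_fin_fun] at hcard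
  let e : Fin (d + 1) ≃ t := (Fintype.equivFinOfCardEq hcard).symm
  exact ⟨fun i => e i, fun i => htV (e i).2,
    det_ne_zero_of_affineIndependent (hti.comp_embedding e.toEmbedding)⟩

/-- The hyperplane cut out by an affine functional weakly separates the points of `w` and `w'`. -/
def Separated {d : ℕ} (w w' : Fin (d + 1) → Fin d → ℝ) : Prop :=
  ∃ g : (Fin d → ℝ) →ᵃ[ℝ] ℝ, (∃ x, g x ≠ 0) ∧ (∀ k, g (w k) ≤ 0) ∧ ∀ k, 0 ≤ g (w' k)

theorem Separated.symm {d : ℕ} {w w' : Fin (d + 1) → Fin d → ℝ} (h : Separated w w') :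
    Separated w' w := by
  obtain ⟨g, ⟨x, hx⟩, h1, h2⟩ := h
  exact ⟨-g, ⟨x, by simpa using hx⟩, fun k => by simpa using h2 k, fun k => by simpa using h1 k⟩

/-- The separating functional is a linear combination of barycentric coordinates. -/
theorem separated_of_bary {d : ℕ} {v w w' : Fin (d + 1) → Fin d → ℝ} (h : (homMat v).det ≠ 0)
    (l : (Fin (d + 1) → ℝ) →ₗ[ℝ] ℝ) (i : Fin (d + 1)) (hi : l (Pi.single i 1) ≠ 0)
    (h1 : ∀ k, l (bary v (w k)) ≤ 0) (h2 : ∀ k, 0 ≤ l (bary v (w' k))) : Separated w w' :=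
  ⟨l.toAffineMap.comp (bary v), ⟨v i, by simpa [bary_self h] using hi⟩, h1, h2⟩

theorem separated_update {d : ℕ} {v : Fin (d + 1) → Fin d → ℝ} (h : (homMat v).det ≠ 0)
    {u : Fin d → ℝ} {j : Fin (d + 1)} (hj : bary v u j < 0) :
    Separated (Function.update v j u) v := by
  refine separated_of_bary h (LinearMap.proj j) j (by simp) (fun k => ?_) fun k => ?_
  · by_cases hk : k = j
    · subst hk; simpa using hj.le
    · simp [hk, bary_self h, Ne.symm hk]
  · by_cases hk : j = k
    · subst hk; simp [bary_self h]
    · simp [bary_self h, hk]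

/-- Combinatorial consequences, for a finite set of lattice points, of having a convex hull of
normalised volume at most four whose lattice points do not span the lattice. -/
structure VolLeFour {d : ℕ} (V : Set (Fin d → ℝ)) : Prop where
  two_le : ∀ v : Fin (d + 1) → Fin d → ℝ, (∀ i, v i ∈ V) → (homMat v).det ≠ 0 → 2 ≤ |(homMat v).det|
  add_le : ∀ w₁ w₂ : Fin (d + 1) → Fin d → ℝ, (∀ i, w₁ i ∈ V) → (∀ i, w₂ i ∈ V) →
    Separated w₁ w₂ → |(homMat w₁).det| + |(homMat w₂).det| ≤ 4
  add_add_le : ∀ w₁ w₂ w₃ : Fin (d + 1) → Fin d → ℝ, (∀ i, w₁ i ∈ V) → (∀ i, w₂ i ∈ V) →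
    (∀ i, w₃ i ∈ V) → Separated w₁ w₂ → Separated w₁ w₃ → Separated w₂ w₃ →
    |(homMat w₁).det| + |(homMat w₂).det| + |(homMat w₃).det| ≤ 4
  exists_neg : ∀ v : Fin (d + 1) → Fin d → ℝ, (∀ i, v i ∈ V) → (homMat v).det ≠ 0 →
    ∃ u ∈ V, ∃ j, bary v u j < 0

theorem VolLeFour.of_polytope {d : ℕ} {P : Set (Fin d → ℝ)} {V : Set (Fin d → ℝ)} (hf : V.Finite)
    (hV : V ⊆ latticePts d) (hPV : P = convexHull ℝ V) (hns : ¬ IsSimplex P) {p : Polynomial ℤ}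
    (hp : HasDeltaPoly P p) (hp4 : p.eval 1 ≤ 4) (hspan : ¬ SpansLattice P) : VolLeFour V := by
  have hVP : V ⊆ P := hPV ▸ subset_convexHull ℝ V
  have hc : IsCompact P := hPV ▸ hf.isCompact_convexHull ℝ
  have hconv : Convex ℝ P := hPV ▸ convex_convexHull ℝ V
  have hp4' : ((p.eval 1 : ℤ) : ℝ) ≤ 4 := by exact_mod_cast hp4
  refine ⟨fun v hv => two_le_abs_det hspan (fun i => hV (hv i)) fun i => hVP (hv i), ?_, ?_, ?_⟩
  · intro w₁ w₂ h₁ h₂ hs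
    have := sum_abs_det_le hp hc hconv ![w₁, w₂] (by
      intro i
      fin_cases i
      exacts [fun k => hVP (h₁ k), fun k => hVP (h₂ k)]) (by
      intro i j hij
      fin_cases i <;> fin_cases j
      exacts [absurd rfl hij, hs, hs.symm, absurd rfl hij])
    simp only [Fin.sum_univ_two] at this
    exact this.trans hp4'
  · intro w₁ w₂ w₃ h₁ h₂ h₃ hs hs' hs''
    have := sum_abs_det_le hp hc hconv ![w₁, w₂, w₃] (by
      intro i
      fin_cases i
      exacts [fun k => hVP (h₁ k), fun k => hVP (h₂ k), fun k => hVP (h₃ k)]) (by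
      intro i j hij
      fin_cases i <;> fin_cases j
      exacts [absurd rfl hij, hs, hs', hs.symm, absurd rfl hij, hs'', hs'.symm, hs''.symm,
        absurd rfl hij])
    simp only [Fin.sum_univ_three] at this
    exact this.trans hp4'
  · intro v hv h0
    by_contra! hcon
    refine hns ⟨d, v, affineIndependent_of_det_ne_zero h0, ?_⟩
    rw [hPV]
    refine (convexHull_min (fun u hu => ?_) (convex_convexHull ℝ _)).antisymm
      (convexHull_mono (Set.range_subset_iff.2 hv))
    exact mem_convexHull_range.2 ⟨bary v u, hcon u hu, isBary_bary h0 u⟩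

namespace VolLeFour

variable {d : ℕ} {V : Set (Fin d → ℝ)} {v : Fin (d + 1) → Fin d → ℝ}

theorem update_mem (hv : ∀ i, v i ∈ V) {u : Fin d → ℝ} (hu : u ∈ V) (j i : Fin (d + 1)) :
    Function.update v j u i ∈ V := by
  by_cases h : i = j
  · subst h; simpa using hu
  · simpa [h] using hv i

theorem det_update_ne_zero (h0 : (homMat v).det ≠ 0) {u : Fin d → ℝ} {j : Fin (d + 1)}
    (hj : bary v u j ≠ 0) : (homMat (Function.update v j u)).det ≠ 0 := by
  rw [(isBary_bary h0 u).det_update j]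
  exact mul_ne_zero hj h0

theorem abs_det_eq (H : VolLeFour V) (hv : ∀ i, v i ∈ V) (h0 : (homMat v).det ≠ 0) :
    |(homMat v).det| = 2 := by
  obtain ⟨u, hu, j, hj⟩ := H.exists_neg v hv h0
  have h1 := H.add_le _ _ (update_mem hv hu j) hv (separated_update h0 hj)
  have h2 := H.two_le _ (update_mem hv hu j) (det_update_ne_zero h0 hj.ne)
  have h3 := H.two_le _ hv h0
  linarith

theorem bary_eq (H : VolLeFour V) (hv : ∀ i, v i ∈ V) (h0 : (homMat v).det ≠ 0) {u : Fin d → ℝ}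
    (hu : u ∈ V) (i : Fin (d + 1)) : bary v u i = 0 ∨ bary v u i = 1 ∨ bary v u i = -1 := by
  by_cases hi : bary v u i = 0
  · exact Or.inl hi
  have h1 := H.abs_det_eq (update_mem hv hu i) (det_update_ne_zero h0 hi)
  rw [(isBary_bary h0 u).det_update i, abs_mul, H.abs_det_eq hv h0] at h1
  exact Or.inr (eq_or_eq_neg_of_abs_eq (by linarith))

theorem bary_neg_unique_self (H : VolLeFour V) (hv : ∀ i, v i ∈ V) (h0 : (homMat v).det ≠ 0)
    {u : Fin d → ℝ} (hu : u ∈ V) {i j : Fin (d + 1)} (hi : bary v u i < 0) (hj : bary v u j < 0) :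
    i = j := by
  by_contra hij
  have hi' : bary v u i = -1 := by
    rcases H.bary_eq hv h0 hu i with h | h | h <;> linarith
  have hj' : bary v u j = -1 := by
    rcases H.bary_eq hv h0 hu j with h | h | h <;> linarith
  have hs : Separated (Function.update v i u) (Function.update v j u) := by
    refine separated_of_bary h0 (LinearMap.proj (R := ℝ) (φ := fun _ => ℝ) i - LinearMap.proj j) i
      ?_ (fun k => ?_) fun k => ?_
    · show (Pi.single i (1 : ℝ) : Fin (d + 1) → ℝ) i - (Pi.single i (1 : ℝ) : Fin (d + 1) → ℝ) j ≠ 0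
      simp [Ne.symm hij]
    · by_cases hk : k = i
      · subst hk; simp [hi', hj']
      · simp only [ne_eq, hk, not_false_eq_true, Function.update_of_ne, bary_self h0,
          LinearMap.sub_apply, LinearMap.proj_apply, Pi.single_apply, Ne.symm hk, if_false]
        split_ifs <;> norm_num
    · by_cases hk : k = j
      · subst hk; simp [hi', hj']
      · simp only [ne_eq, hk, not_false_eq_true, Function.update_of_ne, bary_self h0,
          LinearMap.sub_apply, LinearMap.proj_apply, Pi.single_apply, Ne.symm hk, if_false]
        split_ifs <;> norm_num
  have h1 := H.add_add_le _ _ _ (update_mem hv hu i) (update_mem hv hu j) hv hs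
    (separated_update h0 hi) (separated_update h0 hj)
  rw [H.abs_det_eq (update_mem hv hu i) (det_update_ne_zero h0 hi.ne),
    H.abs_det_eq (update_mem hv hu j) (det_update_ne_zero h0 hj.ne), H.abs_det_eq hv h0] at h1
  norm_num at h1

theorem bary_neg_unique (H : VolLeFour V) (hv : ∀ i, v i ∈ V) (h0 : (homMat v).det ≠ 0)
    {u u' : Fin d → ℝ} (hu : u ∈ V) (hu' : u' ∈ V) {i j : Fin (d + 1)} (hi : bary v u i < 0)
    (hj : bary v u' j < 0) : i = j := by
  by_contra hij
  have hpos : 0 ≤ bary v u' i := by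
    by_contra! h
    exact hij (H.bary_neg_unique_self hv h0 hu' h hj)
  have hs : Separated (Function.update v i u) (Function.update v j u') := by
    refine separated_of_bary h0 (LinearMap.proj i) i (by simp) (fun k => ?_) fun k => ?_
    · by_cases hk : k = i
      · subst hk; simpa using hi.le
      · simp [hk, bary_self h0, Ne.symm hk]
    · by_cases hk : k = j
      · subst hk; simpa using hpos
      · simp only [ne_eq, hk, not_false_eq_true, Function.update_of_ne, bary_self h0,
          LinearMap.proj_apply, Pi.single_apply]
        split_ifs <;> norm_num
  have h1 := H.add_add_le _ _ _ (update_mem hv hu i) (update_mem hv hu' j) hv hs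
    (separated_update h0 hi) (separated_update h0 hj)
  rw [H.abs_det_eq (update_mem hv hu i) (det_update_ne_zero h0 hi.ne),
    H.abs_det_eq (update_mem hv hu' j) (det_update_ne_zero h0 hj.ne), H.abs_det_eq hv h0] at h1
  norm_num at h1

/-- Every point of `V` is a vertex of a given simplex or completes a parallelogram. -/
theorem eq_or_eq_circuit (H : VolLeFour V) (hv : ∀ i, v i ∈ V) (h0 : (homMat v).det ≠ 0)
    {u : Fin d → ℝ} (hu : u ∈ V) : u ∈ Set.range v ∨
      ∃ a b c, a ≠ b ∧ a ≠ c ∧ b ≠ c ∧ u = v a + v b - v c := by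
  set x := bary v u with hx
  have hsum : ∑ i, x i = 1 := (isBary_bary h0 u).1
  have key : ∀ s : Finset (Fin (d + 1)), (∀ i, x i = (if x i = 1 then 1 else 0) -
      if i ∈ s then 1 else 0) → (Finset.univ.filter fun i => x i = 1).card = 1 + s.card := by
    intro s hs
    have : ∑ i, x i = ∑ i, ((if x i = 1 then (1 : ℝ) else 0) - if i ∈ s then 1 else 0) :=
      Finset.sum_congr rfl fun i _ => hs i
    rw [hsum, Finset.sum_sub_distrib, Finset.sum_boole, Finset.sum_boole, Finset.filter_mem_eq_inter,
      Finset.univ_inter] at this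
    have : ((Finset.univ.filter fun i => x i = 1).card : ℝ) = 1 + s.card := by linarith
    exact_mod_cast this
  by_cases hneg : ∃ c, x c < 0
  · right
    obtain ⟨c, hc⟩ := hneg
    have hc1 : ∀ i, x i = -1 ↔ i = c := fun i => by
      constructor
      · intro h
        exact H.bary_neg_unique_self hv h0 hu (by rw [← hx, h]; norm_num) hc
      · rintro rfl
        rcases H.bary_eq hv h0 hu i with h | h | h <;> first | exact h | (rw [← hx] at h; linarith)
    have hx' : ∀ i, x i = (if x i = 1 then 1 else 0) - if i ∈ ({c} : Finset _) then 1 else 0 := by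
      intro i
      simp only [Finset.mem_singleton, ← hc1 i]
      rcases H.bary_eq hv h0 hu i with h | h | h <;> rw [← hx] at h <;> rw [h] <;> norm_num
    have hcard := key {c} hx'
    rw [Finset.card_singleton] at hcard
    obtain ⟨a, b, hab, habs⟩ := Finset.card_eq_two.1 hcard
    have hmem : ∀ i, x i = 1 ↔ i = a ∨ i = b := fun i => by
      have := congrArg (i ∈ ·) habs
      simpa using this
    have hxc := (hc1 c).2 rfl
    refine ⟨a, b, c, hab, ?_, ?_, eq_of_bary_eq h0 ?_⟩
    · rintro rfl
      have := (hmem a).2 (Or.inl rfl)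
      linarith
    · rintro rfl
      have := (hmem b).2 (Or.inr rfl)
      linarith
    · rw [bary_circuit h0, ← hx]
      ext i
      rw [hx' i]
      simp only [hmem, Finset.mem_singleton, Pi.add_apply, Pi.sub_apply, Pi.single_apply]
      by_cases h1 : i = a
      · subst h1; simp [hab]
      · simp [h1]
  · left
    push Not at hneg
    have hx' : ∀ i, x i = (if x i = 1 then 1 else 0) - if i ∈ (∅ : Finset _) then 1 else 0 := by
      intro i
      have := hneg i
      rcases H.bary_eq hv h0 hu i with h | h | h <;> rw [← hx] at h <;> rw [h] at this ⊢ <;>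
        norm_num
      norm_num at this
    have hcard := key ∅ hx'
    rw [Finset.card_empty, add_zero] at hcard
    obtain ⟨a, ha⟩ := Finset.card_eq_one.1 hcard
    have hmem : ∀ i, x i = 1 ↔ i = a := fun i => by
      have := congrArg (i ∈ ·) ha
      simpa using this
    refine ⟨a, eq_of_bary_eq h0 ?_⟩
    rw [bary_self h0, ← hx]
    ext i
    rw [hx' i]
    simp [hmem, Pi.single_apply]

theorem bary_circuit_neg (h0 : (homMat v).det ≠ 0) {a b c : Fin (d + 1)}
    (hac : a ≠ c) (hbc : b ≠ c) : bary v (v a + v b - v c) c < 0 := by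
  simp [bary_circuit h0, Ne.symm hac, Ne.symm hbc]

/-- A non-simplex of normalised volume at most four whose lattice points do not span has exactly
`d + 2` vertices, four of which form a parallelogram. -/
theorem exists_circuit (H : VolLeFour V) (hspan : affineSpan ℝ V = ⊤) :
    ∃ (v : Fin (d + 1) → Fin d → ℝ) (a b c : Fin (d + 1)), |(homMat v).det| = 2 ∧ a ≠ b ∧ a ≠ c ∧
      b ≠ c ∧ V = insert (v a + v b - v c) (Set.range v) := by
  obtain ⟨v, hv, h0⟩ := exists_det_ne_zero hspan
  obtain ⟨u, hu, j, hj⟩ := H.exists_neg v hv h0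
  have hur : u ∉ Set.range v := by
    rintro ⟨i, rfl⟩
    rw [bary_self h0, Pi.single_apply] at hj
    split_ifs at hj <;> norm_num at hj
  obtain ⟨a, b, c, hab, hac, hbc, huv⟩ := (H.eq_or_eq_circuit hv h0 hu).resolve_left hur
  refine ⟨v, a, b, c, H.abs_det_eq hv h0, hab, hac, hbc, ?_⟩
  refine Set.Subset.antisymm (fun u' hu' => ?_) ?_
  · by_contra hu'r
    rw [Set.mem_insert_iff, not_or] at hu'r
    obtain ⟨a', b', c', hab', hac', hbc', huv'⟩ := (H.eq_or_eq_circuit hv h0 hu').resolve_left hu'r.2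
    have hc : c' = c := H.bary_neg_unique hv h0 hu' hu
      (huv' ▸ bary_circuit_neg h0 hac' hbc') (huv ▸ bary_circuit_neg h0 hac hbc)
    subst hc
    have hw := update_mem hv hu c'
    have hw0 := det_update_ne_zero h0 (huv ▸ bary_circuit_neg h0 hac hbc).ne
    set w := Function.update v c' u with hwdef
    have hwc : w c' = u := by simp [hwdef]
    have hwne : ∀ i, i ≠ c' → w i = v i := fun i hi => by simp [hwdef, hi]
    have hvc : v c' = w a + w b - w c' := by
      rw [hwc, hwne a hac, hwne b hbc, huv]; abel
    have hneg : bary w (v c') c' < 0 := by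
      rw [hvc]; exact bary_circuit_neg hw0 hac hbc
    have hcoord : bary w u' = Pi.single a' 1 + Pi.single b' 1 + Pi.single c' 1 - Pi.single a 1 -
        Pi.single b 1 := by
      refine IsBary.bary_eq hw0 ⟨by simp [Finset.sum_add_distrib], fun j => ?_⟩
      simp only [Pi.single_apply, sub_mul, add_mul, Finset.sum_add_distrib, Pi.add_apply, ite_mul,
        Pi.sub_apply, Finset.sum_sub_distrib, one_mul, zero_mul, Finset.mem_univ, if_true,
        Finset.sum_ite_eq']
      rw [hwc, hwne a hac, hwne b hbc, hwne a' hac', hwne b' hbc', huv', huv]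
      simp only [Pi.add_apply, Pi.sub_apply]
      ring
    have hpos : ∀ i, i ≠ c' → 0 ≤ bary w u' i := fun i hi => by
      by_contra! h
      exact hi (H.bary_neg_unique hw hw0 hu' (hv c') h hneg)
    have ha : a = a' ∨ a = b' := by
      by_contra! h
      have := hpos a hac
      simp [hcoord, h.1, h.2, hac, hab] at this
      norm_num at this
    have hb : b = a' ∨ b = b' := by
      by_contra! h
      have := hpos b hbc
      simp [hcoord, h.1, h.2, hbc, Ne.symm hab] at this
      norm_num at this
    refine hu'r.1 ?_
    rw [huv']
    rcases ha with rfl | rfl <;> rcases hb with rfl | rfl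
    · exact absurd rfl hab
    · rfl
    · rw [add_comm]
    · exact absurd rfl hab
  · rintro _ (rfl | ⟨i, rfl⟩)
    · exact huv ▸ hu
    · exact hv i

end VolLeFour

/-- Half the indicator function of `S`. -/
def halfInd {n : ℕ} (S : Finset (Fin n)) (i : Fin n) : ℝ := if i ∈ S then 1 / 2 else 0

theorem two_mul_halfInd_mem {n : ℕ} (S : Finset (Fin n)) (i : Fin n) :
    halfInd S i + halfInd S i ∈ intSubring := by
  unfold halfInd
  split_ifs <;> norm_num

theorem halfInd_mem_iff {n : ℕ} {S : Finset (Fin n)} {i : Fin n} :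
    halfInd S i ∈ intSubring ↔ i ∉ S := by
  unfold halfInd
  split_ifs with h
  · simp only [h, not_true_eq_false, iff_false]
    exact half_notMem_intSubring
  · simp [h]

theorem halfInd_nonneg {n : ℕ} (S : Finset (Fin n)) (i : Fin n) : 0 ≤ halfInd S i := by
  unfold halfInd
  split_ifs <;> norm_num

theorem halfInd_lt_one {n : ℕ} (S : Finset (Fin n)) (i : Fin n) : halfInd S i < 1 := by
  unfold halfInd
  split_ifs <;> norm_num

theorem sum_halfInd {n : ℕ} (S : Finset (Fin n)) : ∑ i, halfInd S i = S.card / 2 := by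
  simp [halfInd, Finset.sum_ite_mem, div_eq_mul_inv]

/-- The combinations of the homogenised vertices lying in the lattice are those whose coefficients
are all integral, or congruent to `halfInd S` modulo the integers. -/
def HalfLat {d : ℕ} (v : Fin (d + 1) → Fin d → ℝ) (S : Finset (Fin (d + 1))) : Prop :=
  ∀ α : Fin (d + 1) → ℝ, (∀ j, ∑ i, α i * homog (v i) j ∈ intSubring) ↔
    (∀ i, α i ∈ intSubring) ∨ ∀ i, α i - halfInd S i ∈ intSubring

theorem exists_halfLat {d : ℕ} {v : Fin (d + 1) → Fin d → ℝ} (hv : ∀ i, v i ∈ latticePts d)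
    (h : |(homMat v).det| = 2) : ∃ S, S.Nonempty ∧ HalfLat v S := by
  classical
  have h0 : (homMat v).det ≠ 0 := by intro h0; simp [h0] at h
  have hM := homMat_mem_intSubring hv
  have hZ : ∀ α : Fin (d + 1) → ℝ, (∀ i, α i ∈ intSubring) →
      ∀ j, ∑ i, α i * homog (v i) j ∈ intSubring :=
    fun α hα j => sum_mem fun i _ => mul_mem (hα i) (hM i j)
  have htwo : ∀ α : Fin (d + 1) → ℝ, (∀ j, ∑ i, α i * homog (v i) j ∈ intSubring) →
      ∀ i, α i * 2 ∈ intSubring := by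
    intro α hα i
    have h1 := Matrix.mul_det_mem_intSubring hM hα i
    rcases eq_or_eq_neg_of_abs_eq h with h2 | h2 <;> rw [h2] at h1
    · exact h1
    · simpa using neg_mem h1
  obtain ⟨α, hα, i₀, hi₀⟩ : ∃ α : Fin (d + 1) → ℝ, (∀ j, ∑ i, α i * homog (v i) j ∈ intSubring) ∧
      ∃ i, α i ∉ intSubring := by
    by_contra! hcon
    choose C hC using fun k : Fin (d + 1) =>
      exists_vecMul_eq h0 ((1 : Matrix (Fin (d + 1)) (Fin (d + 1)) ℝ) k)
    have hCM : Matrix.of C * homMat v = 1 := by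
      ext k j
      rw [Matrix.mul_apply]
      exact hC k j
    have hCint : ∀ k i, C k i ∈ intSubring := fun k => hcon (C k) fun j => by
      have := hC k j
      simp only [homMat_apply] at this
      rw [this, Matrix.one_apply]
      split_ifs
      exacts [one_mem _, zero_mem _]
    have hdet := congrArg Matrix.det hCM
    rw [Matrix.det_mul, Matrix.det_one] at hdet
    have hCdet : (Matrix.of C).det ∈ intSubring := Matrix.det_mem_intSubring hCint
    refine half_notMem_intSubring ?_
    rcases eq_or_eq_neg_of_abs_eq h with h2 | h2 <;> rw [h2] at hdet
    · convert hCdet using 1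
      linarith
    · convert neg_mem hCdet using 1
      linarith
  let S : Finset (Fin (d + 1)) := Finset.univ.filter fun i => α i ∉ intSubring
  have hS : ∀ i, i ∈ S ↔ α i ∉ intSubring := fun i => by simp [S]
  have hαS : ∀ i, α i - halfInd S i ∈ intSubring := by
    intro i
    obtain ⟨z, hz⟩ := mem_intSubring.1 (htwo α hα i)
    by_cases hi : i ∈ S
    · rw [halfInd, if_pos hi]
      have hi' := (hS i).1 hi
      rcases Int.even_or_odd' z with ⟨w, rfl | rfl⟩
      · refine absurd (mem_intSubring.2 ⟨w, ?_⟩) hi'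
        push_cast at hz
        linarith
      · refine mem_intSubring.2 ⟨w, ?_⟩
        push_cast at hz
        linarith
    · rw [halfInd, if_neg hi, sub_zero]
      by_contra h'
      exact hi ((hS i).2 h')
  have hh : ∀ j, ∑ i, halfInd S i * homog (v i) j ∈ intSubring := by
    intro j
    have := sub_mem (hα j) (hZ _ hαS j)
    rw [← Finset.sum_sub_distrib] at this
    refine (congrArg (· ∈ intSubring) (Finset.sum_congr rfl fun i _ => ?_)).mp this
    ring
  have hi₀S : halfInd S i₀ = 1 / 2 := by rw [halfInd, if_pos ((hS i₀).2 hi₀)]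
  refine ⟨S, ⟨i₀, (hS i₀).2 hi₀⟩, fun β => ⟨fun hβ => ?_, ?_⟩⟩
  · let y : Fin (d + 1) → ℝ := fun j => ∑ i, halfInd S i * homog (v i) j
    let γ : Fin (d + 1) → ℝ := fun i => β i - 2 * β i₀ * halfInd S i
    have hγ₀ : γ i₀ = 0 := by simp only [γ, hi₀S]; ring
    let M := (homMat v).updateRow i₀ y
    have hMint : ∀ i j, M i j ∈ intSubring := by
      intro i j
      by_cases hi : i = i₀
      · subst hi
        simp only [M, Matrix.updateRow_self]
        exact hh j
      · simp only [M, Matrix.updateRow_ne hi]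
        exact hM i j
    have hMdet : M.det = (homMat v).det / 2 := by
      have := Matrix.det_updateRow_sum (homMat v) i₀ (halfInd S)
      rw [hi₀S, smul_eq_mul] at this
      have hy : y = ∑ k, halfInd S k • homMat v k := by
        ext j
        simp [y, Finset.sum_apply, homMat_apply]
      rw [show M = (homMat v).updateRow i₀ (∑ k, halfInd S k • homMat v k) by rw [← hy], this]
      ring
    have hsum : ∀ j, ∑ i, (γ i + if i = i₀ then 2 * β i₀ else 0) * M i j =
        ∑ i, β i * homog (v i) j := by
      intro j
      simp only [add_mul, Finset.sum_add_distrib, ite_mul, zero_mul, Finset.sum_ite_eq',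
        Finset.mem_univ, if_true]
      have h1 : ∀ i, γ i * M i j = β i * homog (v i) j - 2 * β i₀ * (halfInd S i * homog (v i) j) := by
        intro i
        by_cases hi : i = i₀
        · subst hi
          rw [hγ₀, hi₀S]
          ring
        · simp only [M, Matrix.updateRow_ne hi, γ, homMat_apply]
          ring
      have h2 : M i₀ j = ∑ i, halfInd S i * homog (v i) j := by
        simp only [M, Matrix.updateRow_self, y]
      rw [Finset.sum_congr rfl fun i _ => h1 i, Finset.sum_sub_distrib, ← Finset.mul_sum, h2]
      ring
    have hres : ∀ i, (γ i + if i = i₀ then 2 * β i₀ else 0) ∈ intSubring := by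
      intro i
      have := Matrix.mul_det_mem_intSubring hMint (fun j => by rw [hsum]; exact hβ j) i
      rw [hMdet] at this
      rcases eq_or_eq_neg_of_abs_eq h with h2 | h2 <;> rw [h2] at this
      · simpa using this
      · simpa using neg_mem this
    obtain ⟨z, hz⟩ := mem_intSubring.1 (hres i₀)
    rw [if_pos rfl, hγ₀, zero_add] at hz
    have hγ : ∀ i, γ i ∈ intSubring := by
      intro i
      by_cases hi : i = i₀
      · subst hi; rw [hγ₀]; exact zero_mem _
      · simpa [hi] using hres i
    have hβγ : ∀ i, β i = γ i + z * halfInd S i := fun i => by simp only [γ, ← hz]; ring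
    rcases Int.even_or_odd' z with ⟨w, rfl | rfl⟩
    · left
      intro i
      rw [hβγ]
      refine add_mem (hγ i) ?_
      push_cast
      rw [mul_comm (2 : ℝ), mul_assoc, two_mul]
      exact mul_mem (intCast_mem_intSubring w) (two_mul_halfInd_mem S i)
    · right
      intro i
      rw [hβγ]
      push_cast
      convert add_mem (hγ i) (mul_mem (intCast_mem_intSubring w) (two_mul_halfInd_mem S i)) using 1
      ring
  · rintro (hβ | hβ)
    · exact hZ β hβ
    · intro j
      have := add_mem (hZ _ hβ j) (hh j)
      rw [← Finset.sum_add_distrib] at this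
      refine (congrArg (· ∈ intSubring) (Finset.sum_congr rfl fun i _ => ?_)).mp this
      ring

namespace HalfLat

variable {d : ℕ} {v : Fin (d + 1) → Fin d → ℝ} {S : Finset (Fin (d + 1))}

theorem mem_latticePts (H : HalfLat v S) (i : Fin (d + 1)) : v i ∈ latticePts d := by
  rw [_root_.mem_latticePts]
  intro j
  have := (H (Pi.single i 1)).2 (Or.inl fun k => by
    rw [Pi.single_apply]; split_ifs; exacts [one_mem _, zero_mem _]) j.castSucc
  simpa [Pi.single_apply] using this

theorem even_card (H : HalfLat v S) : Even S.card := by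
  have := (H (halfInd S)).2 (Or.inr fun i => by simp) (Fin.last d)
  simp only [homog_last, mul_one, sum_halfInd] at this
  obtain ⟨z, hz⟩ := mem_intSubring.1 this
  have : (S.card : ℝ) = (2 * z : ℤ) := by push_cast; linarith
  have : (S.card : ℤ) = 2 * z := by exact_mod_cast this
  rw [← Int.even_coe_nat, this]
  exact even_two_mul z

theorem det_ne_zero (H : HalfLat v S) : (homMat v).det ≠ 0 := by
  intro h0
  obtain ⟨w, hw0, hw⟩ := Matrix.exists_vecMul_eq_zero_iff.2 h0
  obtain ⟨i, hi⟩ := Function.ne_iff.1 hw0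
  rw [Pi.zero_apply] at hi
  have h1 := (H fun k => (4 * w i)⁻¹ * w k).1 fun j => by
    simp_rw [mul_assoc]
    rw [← Finset.mul_sum, show ∑ k, w k * homog (v k) j = 0 from congrFun hw j, mul_zero]
    exact zero_mem _
  have h2 : (4 * w i)⁻¹ * w i + (4 * w i)⁻¹ * w i = 1 / 2 := by
    field_simp
    norm_num
  refine half_notMem_intSubring (h2 ▸ ?_)
  rcases h1 with h1 | h1
  · exact add_mem (h1 i) (h1 i)
  · convert add_mem (add_mem (h1 i) (h1 i)) (two_mul_halfInd_mem S i) using 1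
    ring

/-- Replacing a vertex by an integral combination in which it occurs with coefficient `±1`. -/
theorem update (H : HalfLat v S) {c : Fin (d + 1) → ℝ} (hc : ∀ i, c i ∈ intSubring)
    {p : Fin (d + 1)} (hp : c p = 1 ∨ c p = -1) {u : Fin d → ℝ} (hu : IsBary v u c)
    {S' : Finset (Fin (d + 1))}
    (hS : ∀ i, halfInd S' i + halfInd S' p * (c i - Pi.single (M := fun _ => ℝ) p 1 i) -
      halfInd S i ∈ intSubring) : HalfLat (Function.update v p u) S' := by
  let E : (Fin (d + 1) → ℝ) → Fin (d + 1) → ℝ := fun α i =>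
    α i + α p * (c i - Pi.single (M := fun _ => ℝ) p 1 i)
  have hsingle : ∀ i, Pi.single (M := fun _ => ℝ) p 1 i ∈ intSubring := fun i => by
    rw [Pi.single_apply]
    split_ifs
    exacts [one_mem _, zero_mem _]
  have hE : ∀ α, (∀ i, E α i ∈ intSubring) ↔ ∀ i, α i ∈ intSubring := by
    intro α
    constructor
    · intro h
      have h1 : α p ∈ intSubring := by
        have h2 := h p
        simp only [E, Pi.single_eq_same] at h2
        rcases hp with hp | hp <;> rw [hp] at h2
        · convert h2 using 1
          ring
        · convert neg_mem h2 using 1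
          ring
      intro i
      convert sub_mem (h i) (mul_mem h1 (sub_mem (hc i) (hsingle i))) using 1
      simp only [E]
      ring
    · exact fun h i => add_mem (h i) (mul_mem (h p) (sub_mem (hc i) (hsingle i)))
  have hsum : ∀ α j, ∑ i, α i * homog (Function.update v p u i) j = ∑ i, E α i * homog (v i) j := by
    intro α j
    have h1 : ∀ i, α i * homog (Function.update v p u i) j = α i * homog (v i) j +
        if i = p then α p * (homog u j - homog (v p) j) else 0 := by
      intro i
      split_ifs with hi
      · subst hi
        simp only [Function.update_self]
        ring
      · simp [hi]
    rw [Finset.sum_congr rfl fun i _ => h1 i, Finset.sum_add_distrib, Finset.sum_ite_eq',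
      if_pos (Finset.mem_univ _), ← isBary_iff_homog.1 hu]
    have h2 : ∀ i, E α i * homog (v i) j = α i * homog (v i) j + (α p * (c i * homog (v i) j) -
        if i = p then α p * homog (v p) j else 0) := by
      intro i
      simp only [E, Pi.single_apply]
      split_ifs with hi
      · subst hi; ring
      · ring
    rw [Finset.sum_congr rfl fun i _ => h2 i, Finset.sum_add_distrib, Finset.sum_sub_distrib,
      Finset.sum_ite_eq', if_pos (Finset.mem_univ _), ← Finset.mul_sum]
    ring
  intro α
  simp only [hsum]
  rw [H (E α), hE α]
  refine or_congr_right ?_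
  rw [← hE fun i => α i - halfInd S' i]
  refine forall_congr' fun i => ?_
  have : E α i - halfInd S i = E (fun i => α i - halfInd S' i) i + (halfInd S' i +
      halfInd S' p * (c i - Pi.single (M := fun _ => ℝ) p 1 i) - halfInd S i) := by
    simp only [E]
    ring
  rw [this]
  exact ⟨fun h => by simpa using sub_mem h (hS i), fun h => add_mem h (hS i)⟩

end HalfLat

/-- `P` is the convex hull of the vertices of a simplex and of the fourth vertex of a parallelogram
spanned by three of them; `S` describes the lattice relative to the simplex. -/
structure IsCircuit {d : ℕ} (P : Set (Fin d → ℝ)) (v : Fin (d + 1) → Fin d → ℝ)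
    (S : Finset (Fin (d + 1))) (a b c : Fin (d + 1)) : Prop where
  lat : HalfLat v S
  hab : a ≠ b
  hac : a ≠ c
  hbc : b ≠ c
  eq : P = convexHull ℝ (insert (v a + v b - v c) (Set.range v))

theorem isBary_circuit {d : ℕ} (v : Fin (d + 1) → Fin d → ℝ) (a b c : Fin (d + 1)) :
    IsBary v (v a + v b - v c) (Pi.single a 1 + Pi.single b 1 - Pi.single c 1) := by
  refine ⟨by simp [Finset.sum_add_distrib], fun j => ?_⟩
  simp [Pi.single_apply, sub_mul, add_mul, Finset.sum_add_distrib]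

theorem insert_range_update {ι α : Type*} [DecidableEq ι] (v : ι → α) (p : ι) (u : α) :
    insert (v p) (Set.range (Function.update v p u)) = insert u (Set.range v) := by
  ext x
  simp only [Set.mem_insert_iff, Set.mem_range]
  constructor
  · rintro (rfl | ⟨i, rfl⟩)
    · exact Or.inr ⟨p, rfl⟩
    · by_cases hi : i = p
      · subst hi; simp
      · exact Or.inr ⟨i, by simp [hi]⟩
  · rintro (rfl | ⟨i, rfl⟩)
    · exact Or.inr ⟨p, by simp⟩
    · by_cases hi : i = p
      · subst hi; simp
      · exact Or.inr ⟨i, by simp [hi]⟩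

namespace IsCircuit

variable {d : ℕ} {P : Set (Fin d → ℝ)} {v : Fin (d + 1) → Fin d → ℝ} {S : Finset (Fin (d + 1))}
  {a b c : Fin (d + 1)}

theorem swap (H : IsCircuit P v S a b c) : IsCircuit P v S b a c :=
  ⟨H.lat, H.hab.symm, H.hbc, H.hac, by rw [add_comm (v b)]; exact H.eq⟩

theorem mem (H : IsCircuit P v S a b c) (i : Fin (d + 1)) : v i ∈ P := by
  rw [H.eq]
  exact subset_convexHull ℝ _ (Or.inr ⟨i, rfl⟩)

theorem coeff_mem (i : Fin (d + 1)) :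
    (Pi.single a 1 + Pi.single b 1 - Pi.single c 1 : Fin (d + 1) → ℝ) i ∈ intSubring := by
  simp only [Pi.add_apply, Pi.sub_apply, Pi.single_apply]
  split_ifs <;> norm_num

/-- Exchange `v c` with the opposite vertex of the parallelogram. -/
theorem exchange (H : IsCircuit P v S a b c) (ha : a ∈ S) (hb : b ∈ S) (hc : c ∈ S) :
    IsCircuit P (Function.update v c (v a + v b - v c)) ((S.erase a).erase b) a b c := by
  obtain ⟨hL, hab, hac, hbc, hP⟩ := H
  refine ⟨hL.update coeff_mem (p := c) ?_ (isBary_circuit v a b c) ?_, hab, hac, hbc, ?_⟩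
  · simp [hac.symm, hbc.symm]
  · intro i
    by_cases h1 : i = a
    · subst h1
      simp [halfInd, hab, hac, hac.symm, hbc.symm, ha, hc]
    by_cases h2 : i = b
    · subst h2
      simp [halfInd, hab.symm, hbc, hac.symm, hbc.symm, hb, hc]
    by_cases h3 : i = c
    · subst h3
      simp [halfInd, hac.symm, hbc.symm, hc]
      norm_num
      exact ⟨-1, by norm_num⟩
    · simp [halfInd, h1, h2, h3]
  · rw [hP, ← insert_range_update v c]
    congr 2
    simp [hac, hbc]

/-- Replace `v b` by the fourth vertex of the parallelogram. -/
theorem rotate (H : IsCircuit P v S a b c) (hb : b ∉ S) :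
    IsCircuit P (Function.update v b (v a + v b - v c)) S c b a := by
  obtain ⟨hL, hab, hac, hbc, hP⟩ := H
  refine ⟨hL.update coeff_mem (p := b) ?_ (isBary_circuit v a b c) ?_, hbc.symm, hac.symm,
    hab.symm, ?_⟩
  · simp [hab.symm, hbc]
  · intro i
    simp [halfInd, hb]
  · rw [hP, ← insert_range_update v b]
    congr 2
    simp [hbc.symm, hab]

theorem four_le_card (H : IsCircuit P v S a b c) (hS : S.Nonempty) (hspan : ¬ SpansLattice P) :
    4 ≤ S.card := by
  have h0 := H.lat.det_ne_zero
  have he := H.lat.even_card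
  have hpos := hS.card_pos
  by_contra! hlt
  have h2 : S.card = 2 := by
    rcases he with ⟨m, hm⟩
    omega
  obtain ⟨p, q, hpq, rfl⟩ := Finset.card_eq_two.1 h2
  let m : Fin d → ℝ := fun j => (1 / 2) * v p j + (1 / 2) * v q j
  have hm : ∀ j, homog m j = ∑ i, halfInd {p, q} i * homog (v i) j := by
    intro j
    have : ∀ i, halfInd {p, q} i * homog (v i) j = (if i = p then 1 / 2 * homog (v p) j else 0) +
        if i = q then 1 / 2 * homog (v q) j else 0 := by
      intro i
      by_cases h1 : i = p
      · subst h1; simp [halfInd, hpq]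
      · by_cases h2 : i = q
        · subst h2; simp [halfInd, hpq.symm]
        · simp [halfInd, h1, h2]
    rw [Finset.sum_congr rfl fun i _ => this i, Finset.sum_add_distrib]
    simp only [Finset.sum_ite_eq', Finset.mem_univ, if_true]
    refine Fin.lastCases ?_ (fun j => ?_) j
    · norm_num
    · simp [m]
  have hmP : m ∈ P := by
    have hconv : Convex ℝ P := H.eq ▸ convex_convexHull ℝ _
    have := hconv (H.mem p) (H.mem q) (a := 1 / 2) (b := 1 / 2) (by norm_num) (by norm_num)
      (by norm_num)
    convert this using 1
    ext j
    simp [m]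
  refine hspan (spansLattice_of_forall (ι := Option (Fin (d + 1)))
    (fun o => o.elim m v) ?_ ?_ fun y hy => ?_)
  · rintro (_ | i)
    · rw [Option.elim_none, mem_latticePts]
      intro j
      rw [← homog_castSucc m j, hm]
      exact (H.lat _).2 (Or.inr fun i => by simp) _
    · exact H.lat.mem_latticePts i
  · rintro (_ | i)
    · exact hmP
    · exact H.mem i
  · obtain ⟨α, hα⟩ := exists_vecMul_eq h0 y
    simp only [homMat_apply] at hα
    rcases (H.lat α).1 fun j => by rw [hα]; exact hy j with h | h
    · refine ⟨fun o => o.elim 0 α, ?_, fun j => ?_⟩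
      · rintro (_ | i)
        exacts [zero_mem _, h i]
      · simp [hα]
    · refine ⟨fun o => o.elim 1 fun i => α i - halfInd {p, q} i, ?_, fun j => ?_⟩
      · rintro (_ | i)
        exacts [one_mem _, h i]
      · rw [Fintype.sum_option]
        simp [hm, sub_mul, hα]

theorem affineSpan_eq_top (H : IsCircuit P v S a b c) : affineSpan ℝ P = ⊤ := by
  have h1 := affineIndependent_of_det_ne_zero H.lat.det_ne_zero
  rw [eq_top_iff, ← (h1.affineSpan_eq_top_iff_card_eq_finrank_add_one).2 (by simp)]
  exact affineSpan_mono ℝ (Set.range_subset_iff.2 H.mem)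

/-- Two circuits with lattices of the same type are unimodularly equivalent. -/
theorem unimodEquiv (H : IsCircuit P v S a b c) {P' : Set (Fin d → ℝ)}
    {v' : Fin (d + 1) → Fin d → ℝ} {S' : Finset (Fin (d + 1))} (σ : Equiv.Perm (Fin (d + 1)))
    (H' : IsCircuit P' v' S' (σ a) (σ b) (σ c)) (hS : ∀ i, i ∈ S ↔ σ i ∈ S') :
    UnimodEquiv P P' := by
  have h0 := H.lat.det_ne_zero
  have h0' := H'.lat.det_ne_zero
  let T : (Fin (d + 1) → ℝ) →ₗ[ℝ] (Fin d → ℝ) := Fintype.linearCombination ℝ fun i => v' (σ i)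
  let f : (Fin d → ℝ) →ᵃ[ℝ] (Fin d → ℝ) := T.toAffineMap.comp (bary v)
  have hf : ∀ x, IsBary v' (f x) fun i => bary v x (σ.symm i) := by
    intro x
    refine ⟨by rw [Equiv.sum_comp σ.symm (bary v x)]; exact (isBary_bary h0 x).1, fun j => ?_⟩
    rw [← Equiv.sum_comp σ]
    simp [f, T, Fintype.linearCombination_apply, Finset.sum_apply]
  have hfv : ∀ i, f (v i) = v' (σ i) := by
    intro i
    simp [f, T, bary_self h0, Fintype.linearCombination_apply_single]
  have hfu : f (v a + v b - v c) = v' (σ a) + v' (σ b) - v' (σ c) := by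
    simp [f, T, bary_circuit h0, map_add, map_sub, Fintype.linearCombination_apply_single]
  have hinj : Function.Injective f := by
    intro x y hxy
    refine eq_of_bary_eq h0 (funext fun i => ?_)
    have h1 := (hf x).bary_eq h0'
    rw [hxy, (hf y).bary_eq h0'] at h1
    simpa using (congrFun h1 (σ i)).symm
  have hsurj : ∀ y, ∃ x, f x = y ∧ bary v x = fun i => bary v' y (σ i) := by
    intro y
    let x : Fin d → ℝ := fun j => ∑ i, bary v' y (σ i) * v i j
    have hx : IsBary v x fun i => bary v' y (σ i) :=
      ⟨by rw [Equiv.sum_comp σ (bary v' y)]; exact (isBary_bary h0' y).1, fun j => rfl⟩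
    have hx' := hx.bary_eq h0
    refine ⟨x, eq_of_bary_eq h0' ?_, hx'⟩
    rw [(hf x).bary_eq h0', hx']
    simp
  have hlat : ∀ x, x ∈ latticePts d ↔ f x ∈ latticePts d := by
    have key : ∀ {w : Fin (d + 1) → Fin d → ℝ} {x : Fin d → ℝ} {α : Fin (d + 1) → ℝ},
        IsBary w x α → (x ∈ latticePts d ↔ ∀ j, ∑ i, α i * homog (w i) j ∈ intSubring) := by
      intro w x α h
      rw [_root_.mem_latticePts]
      simp only [isBary_iff_homog.1 h]
      rw [Fin.forall_fin_succ']
      simp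
    intro x
    rw [key (isBary_bary h0 x), key (hf x), H.lat, H'.lat,
      ← σ.forall_congr_right (q := fun i => bary v x (σ.symm i) ∈ intSubring),
      ← σ.forall_congr_right (q := fun i => bary v x (σ.symm i) - halfInd S' i ∈ intSubring)]
    simp [halfInd, hS]
  refine ⟨f, ?_, ?_⟩
  · rw [H.affineSpan_eq_top, H'.affineSpan_eq_top]
    simp only [AffineSubspace.top_coe, Set.inter_univ]
    refine ⟨fun x hx => (hlat x).1 hx, hinj.injOn, fun y hy => ?_⟩
    obtain ⟨x, rfl, _⟩ := hsurj y
    exact ⟨x, (hlat x).2 hy, rfl⟩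
  · rw [H.eq, H'.eq, AffineMap.image_convexHull, Set.image_insert_eq, hfu, ← Set.range_comp]
    congr 2
    ext x
    constructor
    · rintro ⟨i, rfl⟩
      exact ⟨σ i, (hfv i).symm⟩
    · rintro ⟨i, rfl⟩
      exact ⟨σ.symm i, by simp [hfv]⟩

end IsCircuit

/-- The vertices `e_1, …, e_{d-1}, e_1 + ⋯ + e_{d-r-1} + 2 e_d, 0` of a simplex. -/
def modelVert (d r : ℕ) (i : Fin (d + 1)) : Fin d → ℝ :=
  if (i : ℕ) = d then 0
  else if (i : ℕ) + 1 = d then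
    fun j => if (j : ℕ) = d - 1 then 2 else if (j : ℕ) + (r + 1) < d then 1 else 0
  else fun j => if (j : ℕ) = i then 1 else 0

/-- The vertices of `modelVert d r` that take part in the half-integral lattice combination. -/
def modelSupp (d r : ℕ) : Finset (Fin (d + 1)) :=
  Finset.univ.filter fun i => (i : ℕ) + (r + 1) < d ∨ d ≤ i + 1

theorem mem_modelSupp {d r : ℕ} {i : Fin (d + 1)} :
    i ∈ modelSupp d r ↔ (i : ℕ) + (r + 1) < d ∨ d ≤ i + 1 := by
  simp [modelSupp]

theorem card_modelSupp {d r : ℕ} (hr : r + 1 ≤ d) : (modelSupp d r).card = d + 1 - r := by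
  have : (modelSupp d r)ᶜ.map Fin.valEmbedding = Finset.Ico (d - (r + 1)) (d - 1) := by
    ext i
    simp only [Finset.mem_map, Finset.mem_compl, mem_modelSupp, Fin.valEmbedding_apply,
      Finset.mem_Ico]
    constructor
    · rintro ⟨j, hj, rfl⟩
      omega
    · intro hi
      refine ⟨⟨i, by omega⟩, ?_, rfl⟩
      show ¬(i + (r + 1) < d ∨ d ≤ i + 1)
      omega
  have h := congrArg Finset.card this
  rw [Finset.card_map, Finset.card_compl, Fintype.card_fin, Nat.card_Ico] at h
  have := (modelSupp d r).card_le_univ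
  rw [Fintype.card_fin] at this
  omega

theorem sum_mul_modelVert_castSucc {n r : ℕ} (α : Fin (n + 2) → ℝ) (j : Fin n) :
    ∑ i, α i * modelVert (n + 1) r i j.castSucc =
      α j.castSucc.castSucc + if (j : ℕ) + r < n then α (Fin.last n).castSucc else 0 := by
  rw [Fin.sum_univ_castSucc, Fin.sum_univ_castSucc]
  have h1 : ∀ i : Fin n, modelVert (n + 1) r i.castSucc.castSucc j.castSucc =
      if i = j then 1 else 0 := by
    intro i
    have := i.2
    simp only [modelVert, Fin.val_castSucc, Fin.ext_iff]
    rw [if_neg (by omega), if_neg (by omega)]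
    simp only [Fin.val_castSucc, eq_comm]
  have h2 : modelVert (n + 1) r (Fin.last n).castSucc j.castSucc =
      if (j : ℕ) + r < n then 1 else 0 := by
    have := j.2
    simp only [modelVert, Fin.val_castSucc, Fin.val_last]
    rw [if_neg (by omega), if_pos trivial, if_neg (by rw [Fin.val_castSucc]; omega)]
    refine if_congr ?_ rfl rfl
    rw [Fin.val_castSucc]
    omega
  have h3 : modelVert (n + 1) r (Fin.last (n + 1)) j.castSucc = 0 := by simp [modelVert]
  simp [h1, h2, h3]

theorem sum_mul_modelVert_last {n r : ℕ} (α : Fin (n + 2) → ℝ) :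
    ∑ i, α i * modelVert (n + 1) r i (Fin.last n) = 2 * α (Fin.last n).castSucc := by
  rw [Fin.sum_univ_castSucc, Fin.sum_univ_castSucc]
  have h1 : ∀ i : Fin n, modelVert (n + 1) r i.castSucc.castSucc (Fin.last n) = 0 := by
    intro i
    have := i.2
    simp only [modelVert, Fin.val_castSucc]
    rw [if_neg (by omega), if_neg (by omega), if_neg (by rw [Fin.val_last]; omega)]
  have h2 : modelVert (n + 1) r (Fin.last n).castSucc (Fin.last n) = 2 := by simp [modelVert]
  have h3 : modelVert (n + 1) r (Fin.last (n + 1)) (Fin.last n) = 0 := by simp [modelVert]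
  simp [h1, h2, h3, mul_comm]

theorem halfLat_modelVert {d r : ℕ} (hr : r + 1 ≤ d) (he : Even (d + 1 - r)) :
    HalfLat (modelVert d r) (modelSupp d r) := by
  rw [← card_modelSupp hr] at he
  obtain ⟨n, rfl⟩ : ∃ n, d = n + 1 := ⟨d - 1, by omega⟩
  have hhalf : ∀ j : Fin n, halfInd (modelSupp (n + 1) r) j.castSucc.castSucc =
      if (j : ℕ) + r < n then 1 / 2 else 0 := by
    intro j
    have := j.2
    rw [halfInd]
    refine if_congr ?_ rfl rfl
    rw [mem_modelSupp]
    simp only [Fin.val_castSucc]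
    omega
  have hhalf' : halfInd (modelSupp (n + 1) r) (Fin.last n).castSucc = 1 / 2 := by
    rw [halfInd, if_pos (mem_modelSupp.2 (Or.inr (by simp)))]
  have hsumS : ∑ i, halfInd (modelSupp (n + 1) r) i ∈ intSubring := by
    obtain ⟨m, hm⟩ := he
    rw [sum_halfInd, hm]
    refine mem_intSubring.2 ⟨m, ?_⟩
    push_cast
    ring
  intro α
  rw [Fin.forall_fin_succ', Fin.forall_fin_succ']
  simp only [homog_castSucc, homog_last, sum_mul_modelVert_castSucc, sum_mul_modelVert_last, mul_one]
  constructor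
  · rintro ⟨⟨h1, h2⟩, h3⟩
    obtain ⟨z, hz⟩ := mem_intSubring.1 h2
    rcases Int.even_or_odd' z with ⟨w, rfl | rfl⟩
    · left
      have h4 : α (Fin.last n).castSucc ∈ intSubring := mem_intSubring.2 ⟨w, by
        push_cast at hz; linarith⟩
      have h5 : ∀ j : Fin n, α j.castSucc.castSucc ∈ intSubring := by
        intro j
        have := h1 j
        split_ifs at this
        · simpa using sub_mem this h4
        · simpa using this
      have h6 : ∀ i : Fin (n + 1), α i.castSucc ∈ intSubring := by
        rw [Fin.forall_fin_succ']
        exact ⟨h5, h4⟩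
      rw [Fin.forall_fin_succ']
      refine ⟨h6, ?_⟩
      rw [Fin.sum_univ_castSucc] at h3
      convert sub_mem h3 (sum_mem fun i (_ : i ∈ Finset.univ) => h6 i) using 1
      ring
    · right
      have h4 : α (Fin.last n).castSucc - 1 / 2 ∈ intSubring := mem_intSubring.2 ⟨w, by
        push_cast at hz; linarith⟩
      have h5 : ∀ j : Fin n, α j.castSucc.castSucc -
          halfInd (modelSupp (n + 1) r) j.castSucc.castSucc ∈ intSubring := by
        intro j
        have := h1 j
        rw [hhalf]
        split_ifs at this ⊢
        · convert sub_mem (sub_mem this h4) (one_mem intSubring) using 1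
          ring
        · simpa using this
      have h6 : ∀ i : Fin (n + 1), α i.castSucc -
          halfInd (modelSupp (n + 1) r) i.castSucc ∈ intSubring := by
        rw [Fin.forall_fin_succ']
        exact ⟨h5, by rw [hhalf']; exact h4⟩
      rw [Fin.forall_fin_succ']
      refine ⟨h6, ?_⟩
      have h7 := sub_mem h3 hsumS
      rw [← Finset.sum_sub_distrib, Fin.sum_univ_castSucc] at h7
      convert sub_mem h7 (sum_mem fun i (_ : i ∈ Finset.univ) => h6 i) using 1
      ring
  · rintro (h | h)
    · refine ⟨⟨fun j => add_mem (h _) ?_, ?_⟩, sum_mem fun i _ => h i⟩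
      · split_ifs
        exacts [h _, zero_mem _]
      · rw [two_mul]
        exact add_mem (h _) (h _)
    · have h4 := h (Fin.last n).castSucc
      rw [hhalf'] at h4
      refine ⟨⟨fun j => ?_, ?_⟩, ?_⟩
      · have h5 := h j.castSucc.castSucc
        rw [hhalf] at h5
        split_ifs at h5 ⊢
        · convert add_mem (add_mem h5 h4) (one_mem intSubring) using 1
          ring
        · simpa using h5
      · convert add_mem (add_mem h4 h4) (one_mem intSubring) using 1
        ring
      · convert add_mem (sum_mem fun i (_ : i ∈ Finset.univ) => h i) hsumS using 1
        rw [← Finset.sum_add_distrib]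
        simp

theorem range_modelVert {d r : ℕ} (hd : 1 ≤ d) : Set.range (modelVert d r) =
    ({0, fun j : Fin d => if (j : ℕ) = d - 1 then (2 : ℝ) else
      if (j : ℕ) + (r + 1) < d then 1 else 0} : Set (Fin d → ℝ)) ∪
      {x | ∃ j : Fin d, (j : ℕ) < d - 1 ∧ x = stdE d j} := by
  ext x
  simp only [Set.mem_range, Set.mem_union, Set.mem_insert_iff, Set.mem_singleton_iff,
    Set.mem_ofPred_eq]
  constructor
  · rintro ⟨i, rfl⟩
    have := i.2
    unfold modelVert
    split_ifs with h1 h2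
    · exact Or.inl (Or.inl rfl)
    · exact Or.inl (Or.inr rfl)
    · refine Or.inr ⟨⟨i, by omega⟩, show (i : ℕ) < d - 1 by omega, ?_⟩
      ext j
      simp [stdE, Fin.ext_iff]
  · rintro ((rfl | rfl) | ⟨j, hj, rfl⟩)
    · exact ⟨Fin.last d, by simp [modelVert]⟩
    · refine ⟨⟨d - 1, by omega⟩, ?_⟩
      unfold modelVert
      rw [if_neg (by simp only; omega), if_pos (by simp only; omega)]
    · refine ⟨j.castSucc, ?_⟩
      unfold modelVert
      simp only [Fin.val_castSucc]
      rw [if_neg (by omega), if_neg (by omega)]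
      ext i
      simp [stdE, Fin.ext_iff]

/-- Criterion for a polytope given by its vertices to be a circuit over `modelVert`. -/
theorem isCircuit_modelVert {d r : ℕ} (hr : r + 1 ≤ d) (he : Even (d + 1 - r))
    {a b c : Fin (d + 1)} (hab : a ≠ b) (hac : a ≠ c) (hbc : b ≠ c) {u : Fin d → ℝ}
    (hu : u = modelVert d r a + modelVert d r b - modelVert d r c) :
    IsCircuit (convexHull ℝ ({0, fun j : Fin d => if (j : ℕ) = d - 1 then (2 : ℝ) else
      if (j : ℕ) + (r + 1) < d then 1 else 0, u} ∪
      {x | ∃ j : Fin d, (j : ℕ) < d - 1 ∧ x = stdE d j})) (modelVert d r) (modelSupp d r) a b c := by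
  refine ⟨halfLat_modelVert hr he, hab, hac, hbc, ?_⟩
  rw [range_modelVert (by omega), ← hu]
  congr 1
  ext x
  simp only [Set.mem_union, Set.mem_insert_iff, Set.mem_singleton_iff]
  tauto

theorem modelVert_eq_single {d r : ℕ} {i : ℕ} (hi : i + 1 < d) :
    modelVert d r ⟨i, by omega⟩ = fun j : Fin d => if (j : ℕ) = i then (1 : ℝ) else 0 := by
  unfold modelVert
  rw [if_neg (by simp only; omega), if_neg (by simp only; omega)]

theorem modelVert_last {d r : ℕ} : modelVert d r (Fin.last d) = 0 := by simp [modelVert]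

theorem isCircuit_polyA41 {d : ℕ} (hd : 4 ≤ d) (he : Even d) :
    IsCircuit (polyA41 d) (modelVert d 1) (modelSupp d 1) ⟨0, by omega⟩ (Fin.last d)
      ⟨d - 2, by omega⟩ := by
  refine isCircuit_modelVert (by omega) (by simpa using he) ?_ ?_ ?_ ?_
  · rw [Ne, Fin.ext_iff, Fin.val_last]; simp only; omega
  · rw [Ne, Fin.ext_iff]; simp only; omega
  · rw [Ne, Fin.ext_iff, Fin.val_last]; simp only; omega
  · rw [modelVert_last, modelVert_eq_single (by omega), modelVert_eq_single (by omega)]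
    ext j
    simp only [Pi.add_apply, Pi.sub_apply, Pi.zero_apply]
    split_ifs <;> first | omega | norm_num

theorem isCircuit_polyB4 {d : ℕ} (hd : 4 ≤ d) (he : Even d) :
    IsCircuit (polyB4 d) (modelVert d 1) (modelSupp d 1) (Fin.last d) ⟨d - 2, by omega⟩
      ⟨0, by omega⟩ := by
  refine isCircuit_modelVert (by omega) (by simpa using he) ?_ ?_ ?_ ?_
  · rw [Ne, Fin.ext_iff, Fin.val_last]; simp only; omega
  · rw [Ne, Fin.ext_iff, Fin.val_last]; simp only; omega
  · rw [Ne, Fin.ext_iff]; simp only; omega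
  · rw [modelVert_last, modelVert_eq_single (by omega), modelVert_eq_single (by omega)]
    ext j
    simp only [Pi.add_apply, Pi.sub_apply, Pi.zero_apply]
    split_ifs <;> first | omega | norm_num

theorem isCircuit_polyA42 {d : ℕ} (hd : 4 ≤ d) (he : Even (d + 1 - 2)) :
    IsCircuit (polyA42 d) (modelVert d 2) (modelSupp d 2) ⟨d - 3, by omega⟩ ⟨d - 2, by omega⟩
      (Fin.last d) := by
  refine isCircuit_modelVert (by omega) he ?_ ?_ ?_ ?_
  · rw [Ne, Fin.ext_iff]; simp only; omega
  · rw [Ne, Fin.ext_iff, Fin.val_last]; simp only; omega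
  · rw [Ne, Fin.ext_iff, Fin.val_last]; simp only; omega
  · rw [modelVert_last, modelVert_eq_single (by omega), modelVert_eq_single (by omega)]
    ext j
    simp only [Pi.add_apply, Pi.sub_apply, Pi.zero_apply]
    split_ifs <;> first | omega | norm_num

theorem isCircuit_polyA43 {d : ℕ} (hd : 4 ≤ d) (he : Even (d + 1 - 3)) :
    IsCircuit (polyA43 d) (modelVert d 3) (modelSupp d 3) ⟨d - 3, by omega⟩ ⟨d - 2, by omega⟩
      ⟨d - 4, by omega⟩ := by
  refine isCircuit_modelVert (by omega) he ?_ ?_ ?_ ?_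
  · rw [Ne, Fin.ext_iff]; simp only; omega
  · rw [Ne, Fin.ext_iff]; simp only; omega
  · rw [Ne, Fin.ext_iff]; simp only; omega
  · rw [modelVert_eq_single (by omega), modelVert_eq_single (by omega),
      modelVert_eq_single (by omega)]
    ext j
    simp only [Pi.add_apply, Pi.sub_apply]
    split_ifs <;> first | omega | norm_num

/-- The map `x ↦ (x, 0)`. -/
def snocZero (e : ℕ) : (Fin e → ℝ) →ₗ[ℝ] (Fin (e + 1) → ℝ) where
  toFun x := Fin.snoc (α := fun _ => ℝ) x 0
  map_add' x y := by
    ext i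
    refine Fin.lastCases ?_ (fun i => ?_) i <;> simp
  map_smul' r x := by
    ext i
    refine Fin.lastCases ?_ (fun i => ?_) i <;> simp

@[simp] theorem snocZero_castSucc {e : ℕ} (x : Fin e → ℝ) (j : Fin e) :
    snocZero e x j.castSucc = x j := by simp [snocZero]

@[simp] theorem snocZero_last {e : ℕ} (x : Fin e → ℝ) : snocZero e x (Fin.last e) = 0 := by
  simp [snocZero]

/-- The vertices of the pyramid over a simplex. -/
def pyrVert {e : ℕ} (w : Fin (e + 1) → Fin e → ℝ) : Fin (e + 2) → Fin (e + 1) → ℝ :=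
  Fin.snoc (α := fun _ => Fin (e + 1) → ℝ) (fun p => snocZero e (w p)) (Pi.single (Fin.last e) 1)

@[simp] theorem pyrVert_castSucc {e : ℕ} (w : Fin (e + 1) → Fin e → ℝ) (p : Fin (e + 1)) :
    pyrVert w p.castSucc = snocZero e (w p) := by simp [pyrVert]

@[simp] theorem pyrVert_last {e : ℕ} (w : Fin (e + 1) → Fin e → ℝ) :
    pyrVert w (Fin.last (e + 1)) = Pi.single (Fin.last e) 1 := by simp [pyrVert]

theorem HalfLat.pyrVert {e : ℕ} {w : Fin (e + 1) → Fin e → ℝ} {S : Finset (Fin (e + 1))}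
    (H : HalfLat w S) : HalfLat (pyrVert w) (S.map Fin.castSuccEmb) := by
  have h1 : ∀ i, halfInd (S.map Fin.castSuccEmb) (Fin.castSucc i) = halfInd S i := by
    intro i
    simp [halfInd]
  have h2 : halfInd (S.map Fin.castSuccEmb) (Fin.last (e + 1)) = 0 := by
    simp [halfInd]
  intro α
  rw [Fin.forall_fin_succ' (P := fun i => α i ∈ intSubring), Fin.forall_fin_succ'
    (P := fun i => α i - halfInd (S.map Fin.castSuccEmb) i ∈ intSubring)]
  simp only [h1, h2, sub_zero]
  rw [← or_and_right, ← H fun i => α i.castSucc, Fin.forall_fin_succ', Fin.forall_fin_succ',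
    Fin.forall_fin_succ']
  simp only [homog_castSucc, homog_last, mul_one]
  have h3 : ∀ q : Fin e, ∑ i, α i * _root_.pyrVert w i q.castSucc =
      ∑ i : Fin (e + 1), α i.castSucc * w i q := by
    intro q
    rw [Fin.sum_univ_castSucc]
    simp [Fin.castSucc_ne_last]
  have h4 : ∑ i, α i * _root_.pyrVert w i (Fin.last e) = α (Fin.last (e + 1)) := by
    rw [Fin.sum_univ_castSucc]
    simp
  simp only [h3, h4]
  rw [Fin.sum_univ_castSucc, and_assoc, and_assoc]
  refine and_congr_right fun _ => ?_
  constructor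
  · rintro ⟨h5, h6⟩
    exact ⟨by simpa using sub_mem h6 h5, h5⟩
  · rintro ⟨h5, h6⟩
    exact ⟨h6, add_mem h5 h6⟩

theorem IsCircuit.isLatticePolytope {d : ℕ} {P : Set (Fin d → ℝ)} {v : Fin (d + 1) → Fin d → ℝ}
    {S : Finset (Fin (d + 1))} {a b c : Fin (d + 1)} (H : IsCircuit P v S a b c) :
    IsLatticePolytope P := by
  have hf : (insert (v a + v b - v c) (Set.range v)).Finite := (Set.finite_range v).insert _
  refine ⟨hf.toFinset, ?_, by rw [hf.coe_toFinset]; exact H.eq⟩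
  rw [hf.coe_toFinset]
  rintro _ (rfl | ⟨i, rfl⟩)
  · rw [mem_latticePts]
    intro j
    have h := fun i => _root_.mem_latticePts.1 (H.lat.mem_latticePts i) j
    exact sub_mem (add_mem (h a) (h b)) (h c)
  · exact H.lat.mem_latticePts i

theorem IsCircuit.pyramidOver {e : ℕ} {Q : Set (Fin e → ℝ)} {w : Fin (e + 1) → Fin e → ℝ}
    {S : Finset (Fin (e + 1))} {a b c : Fin (e + 1)} (H : IsCircuit Q w S a b c) :
    IsCircuit (pyramidOver Q) (pyrVert w) (S.map Fin.castSuccEmb) a.castSucc b.castSucc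
      c.castSucc := by
  refine ⟨H.lat.pyrVert, by simpa using H.hab, by simpa using H.hac, by simpa using H.hbc, ?_⟩
  have h1 : (fun x : Fin e → ℝ => (Fin.snoc x (0 : ℝ) : Fin (e + 1) → ℝ)) '' Q =
      convexHull ℝ (snocZero e '' insert (w a + w b - w c) (Set.range w)) := by
    rw [← LinearMap.image_convexHull, ← H.eq]
    rfl
  have h2 : (Fin.snoc (0 : Fin e → ℝ) (1 : ℝ) : Fin (e + 1) → ℝ) = Pi.single (Fin.last e) 1 := by
    ext i
    refine Fin.lastCases ?_ (fun i => ?_) i <;> simp [Fin.castSucc_ne_last]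
  rw [_root_.pyramidOver, h1, h2, convexHull_convexHull_union_left, Set.image_insert_eq]
  congr 1
  ext x
  simp only [pyrVert_castSucc, map_add, map_sub, Set.mem_union, Set.mem_insert_iff,
    Set.mem_singleton_iff, Set.mem_range, Set.mem_image]
  rw [Fin.exists_fin_succ']
  simp only [pyrVert_castSucc, pyrVert_last, exists_exists_eq_and, @eq_comm _ x, or_assoc]

theorem exists_perm_map_eq {n : ℕ} {S T : Finset (Fin n)} (h : S.card = T.card) {i j : Fin n}
    (hi : i ∉ S) (hj : j ∉ T) : ∃ σ : Equiv.Perm (Fin n), σ i = j ∧ ∀ k, k ∈ S ↔ σ k ∈ T := by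
  let e : {k // k ∈ S} ≃ {k // k ∈ T} := Finset.equivOfCardEq h
  let τ : Equiv.Perm (Fin n) := e.extendSubtype
  have hτ : ∀ k, k ∈ S ↔ τ k ∈ T := fun k =>
    ⟨fun hk => e.extendSubtype_mem k hk, fun hk => by
      by_contra hk'
      exact e.extendSubtype_not_mem k hk' hk⟩
  have hτi : τ i ∉ T := fun h => hi ((hτ i).2 h)
  refine ⟨τ.trans (Equiv.swap (τ i) j), by simp, fun k => ?_⟩
  rw [hτ, Equiv.trans_apply]
  by_cases h1 : τ k = τ i
  · rw [h1, Equiv.swap_apply_left]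
    exact iff_of_false hτi hj
  by_cases h2 : τ k = j
  · rw [h2, Equiv.swap_apply_right]
    exact iff_of_false hj hτi
  · rw [Equiv.swap_apply_of_ne_of_ne h1 h2]

/-- A vertex outside of the parallelogram which does not take part in the half-integral lattice
combination is the apex of a lattice pyramid. -/
theorem IsCircuit.isLatticePyramid {d : ℕ} {P : Set (Fin d → ℝ)} {v : Fin (d + 1) → Fin d → ℝ}
    {S : Finset (Fin (d + 1))} {a b c : Fin (d + 1)} (H : IsCircuit P v S a b c)
    (hS : 2 ≤ S.card) {i : Fin (d + 1)} (hi : i ∉ S) (ha : i ≠ a) (hb : i ≠ b) (hc : i ≠ c) :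
    IsLatticePyramid P := by
  have hcard : S.card ≤ d := by
    have := Finset.card_lt_univ_of_notMem hi
    rw [Fintype.card_fin] at this
    omega
  obtain ⟨e, rfl⟩ : ∃ e, d = e + 1 := ⟨d - 1, by omega⟩
  have hr : e + 1 - S.card + 1 ≤ e := by omega
  have he : Even (e + 1 - (e + 1 - S.card)) := by
    convert H.lat.even_card using 1
    omega
  have hcard' : S.card = ((modelSupp e (e + 1 - S.card)).map Fin.castSuccEmb).card := by
    rw [Finset.card_map, card_modelSupp hr]
    omega
  obtain ⟨σ, hσi, hσ⟩ := exists_perm_map_eq hcard' hi (j := Fin.last (e + 1)) (by simp)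
  have hlast : ∀ k, i ≠ k → ∃ k' : Fin (e + 1), k'.castSucc = σ k := fun k hk =>
    Fin.exists_castSucc_eq.2 fun h => hk (σ.injective (hσi.trans h.symm))
  obtain ⟨a', ha'⟩ := hlast a ha
  obtain ⟨b', hb'⟩ := hlast b hb
  obtain ⟨c', hc'⟩ := hlast c hc
  have hne : ∀ {k l : Fin (e + 2)} {k' l' : Fin (e + 1)}, k'.castSucc = σ k → l'.castSucc = σ l →
      k ≠ l → k' ≠ l' := by
    rintro k l k' l' h1 h2 h3 rfl
    exact h3 (σ.injective (h1.symm.trans h2))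
  have H' : IsCircuit _ _ _ a' b' c' := ⟨halfLat_modelVert hr he, hne ha' hb' H.hab,
    hne ha' hc' H.hac, hne hb' hc' H.hbc, rfl⟩
  have hpyr := H'.pyramidOver
  rw [ha', hb', hc'] at hpyr
  exact ⟨e, _, H'.isLatticePolytope, H'.affineSpan_eq_top, H.unimodEquiv σ hpyr hσ⟩

theorem exists_perm_of_three {n : ℕ} {a b c a' b' c' : Fin n} (hab : a ≠ b) (hac : a ≠ c)
    (hbc : b ≠ c) (hab' : a' ≠ b') (hac' : a' ≠ c') (hbc' : b' ≠ c') :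
    ∃ σ : Equiv.Perm (Fin n), σ a = a' ∧ σ b = b' ∧ σ c = c' := by
  have hinj : ∀ {a b c : Fin n}, a ≠ b → a ≠ c → b ≠ c → Function.Injective ![a, b, c] := by
    intro a b c hab hac hbc i j hij
    fin_cases i <;> fin_cases j <;> simp_all
  obtain ⟨σ, hσ⟩ := (Equiv.Perm.isMultiplyPretransitive (Fin n) 3).exists_smul_eq
    ⟨_, hinj hab hac hbc⟩ ⟨_, hinj hab' hac' hbc'⟩
  exact ⟨σ, congrArg (fun f => f 0) hσ, congrArg (fun f => f 1) hσ, congrArg (fun f => f 2) hσ⟩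

/-- Exchanging vertices of the parallelogram, one reaches one of four positions of the lattice
relative to the simplex. -/
theorem IsCircuit.exists_normal_form {d : ℕ} {P : Set (Fin d → ℝ)} {v : Fin (d + 1) → Fin d → ℝ}
    {S : Finset (Fin (d + 1))} {a b c : Fin (d + 1)} (H : IsCircuit P v S a b c)
    (hS : S.Nonempty) (hspan : ¬SpansLattice P) (hpyr : ¬IsLatticePyramid P) :
    ∃ (v : Fin (d + 1) → Fin d → ℝ) (S : Finset (Fin (d + 1))) (a b c : Fin (d + 1)),
      IsCircuit P v S a b c ∧ 4 ≤ S.card ∧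
        (Sᶜ = {c} ∨ Sᶜ = {b} ∨ Sᶜ = {a, b} ∨ Sᶜ = {a, b, c}) := by
  have hcard := H.four_le_card hS hspan
  have hout : ∀ i, i ∉ S → i = a ∨ i = b ∨ i = c := by
    intro i hi
    by_contra! h
    exact hpyr (H.isLatticePyramid (by omega) hi h.1 h.2.1 h.2.2)
  have hab := H.hab
  have hac := H.hac
  have hbc := H.hbc
  by_cases ha : a ∈ S <;> by_cases hb : b ∈ S <;> by_cases hc : c ∈ S
  · have H' := H.exchange ha hb hc
    have hc' : c ∈ (S.erase a).erase b := by simp [hac.symm, hbc.symm, hc]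
    refine ⟨_, _, a, b, c, H', H'.four_le_card ⟨c, hc'⟩ hspan, Or.inr (Or.inr (Or.inl ?_))⟩
    ext i
    simp only [Finset.mem_compl, Finset.mem_erase, Finset.mem_insert, Finset.mem_singleton]
    grind
  · refine ⟨v, S, a, b, c, H, hcard, Or.inl ?_⟩
    ext i
    simp only [Finset.mem_compl, Finset.mem_singleton]
    grind
  · refine ⟨v, S, a, b, c, H, hcard, Or.inr (Or.inl ?_)⟩
    ext i
    simp only [Finset.mem_compl, Finset.mem_singleton]
    grind
  · refine ⟨_, S, c, b, a, H.rotate hb, hcard, Or.inr (Or.inr (Or.inl ?_))⟩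
    ext i
    simp only [Finset.mem_compl, Finset.mem_insert, Finset.mem_singleton]
    grind
  · refine ⟨v, S, b, a, c, H.swap, hcard, Or.inr (Or.inl ?_)⟩
    ext i
    simp only [Finset.mem_compl, Finset.mem_singleton]
    grind
  · refine ⟨_, S, c, a, b, H.swap.rotate ha, hcard, Or.inr (Or.inr (Or.inl ?_))⟩
    ext i
    simp only [Finset.mem_compl, Finset.mem_insert, Finset.mem_singleton]
    grind
  · refine ⟨v, S, a, b, c, H, hcard, Or.inr (Or.inr (Or.inl ?_))⟩
    ext i
    simp only [Finset.mem_compl, Finset.mem_insert, Finset.mem_singleton]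
    grind
  · refine ⟨v, S, a, b, c, H, hcard, Or.inr (Or.inr (Or.inr ?_))⟩
    ext i
    simp only [Finset.mem_compl, Finset.mem_insert, Finset.mem_singleton]
    grind

/-- A lattice polytope satisfying the hypotheses of the classification is presented by a
parallelogram attached to a simplex of normalized volume two. -/
theorem exists_isCircuit {d : ℕ} {P : Set (Fin d → ℝ)} (hP : IsLatticePolytope P)
    (hdim : affineSpan ℝ P = ⊤) (hns : ¬IsSimplex P) {p : Polynomial ℤ} (hp : HasDeltaPoly P p)
    (hp4 : p.eval 1 ≤ 4) (hspan : ¬SpansLattice P) :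
    ∃ (v : Fin (d + 1) → Fin d → ℝ) (S : Finset (Fin (d + 1))) (a b c : Fin (d + 1)),
      IsCircuit P v S a b c ∧ S.Nonempty := by
  obtain ⟨V, hV, hPV⟩ := hP
  have H := VolLeFour.of_polytope V.finite_toSet hV hPV hns hp hp4 hspan
  rw [hPV, affineSpan_convexHull] at hdim
  obtain ⟨v, a, b, c, hdet, hab, hac, hbc, hVeq⟩ := H.exists_circuit hdim
  obtain ⟨S, hS, hlat⟩ := exists_halfLat (v := v)
    (fun i => hV (hVeq ▸ Or.inr ⟨i, rfl⟩)) hdet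
  exact ⟨v, S, a, b, c, ⟨hlat, hab, hac, hbc, by rw [hPV, hVeq]⟩, hS⟩

/-- Equality of the complements suffices to compare two presentations of circuits. -/
theorem IsCircuit.unimodEquiv_of_compl {d : ℕ} {P P' : Set (Fin d → ℝ)}
    {v v' : Fin (d + 1) → Fin d → ℝ} {S S' : Finset (Fin (d + 1))} {a b c a' b' c' : Fin (d + 1)}
    (H : IsCircuit P v S a b c) (H' : IsCircuit P' v' S' a' b' c')
    (hS : ∀ σ : Equiv.Perm (Fin (d + 1)), σ a = a' → σ b = b' → σ c = c' →
      Sᶜ.map σ.toEmbedding = S'ᶜ) : UnimodEquiv P P' := by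
  obtain ⟨σ, rfl, rfl, rfl⟩ := exists_perm_of_three H.hab H.hac H.hbc H'.hab H'.hac H'.hbc
  refine H.unimodEquiv σ H' fun i => not_iff_not.1 ?_
  rw [← Finset.mem_compl, ← Finset.mem_compl, ← hS σ rfl rfl rfl]
  simp

theorem IsCircuit.unimodEquiv_polyA41 {d : ℕ} {P : Set (Fin d → ℝ)} {v : Fin (d + 1) → Fin d → ℝ}
    {S : Finset (Fin (d + 1))} {a b c : Fin (d + 1)} (H : IsCircuit P v S a b c) (hd : 4 ≤ d)
    (he : Even d) (hS : Sᶜ = {c}) : UnimodEquiv P (polyA41 d) := by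
  refine H.unimodEquiv_of_compl (isCircuit_polyA41 hd he) ?_
  intro σ h1 h2 h3
  rw [hS, Finset.map_singleton, Equiv.coe_toEmbedding, h3]
  ext i
  simp only [Finset.mem_compl, mem_modelSupp, Finset.mem_singleton, Fin.ext_iff]
  omega

theorem IsCircuit.unimodEquiv_polyB4 {d : ℕ} {P : Set (Fin d → ℝ)} {v : Fin (d + 1) → Fin d → ℝ}
    {S : Finset (Fin (d + 1))} {a b c : Fin (d + 1)} (H : IsCircuit P v S a b c) (hd : 4 ≤ d)
    (he : Even d) (hS : Sᶜ = {b}) : UnimodEquiv P (polyB4 d) := by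
  refine H.unimodEquiv_of_compl (isCircuit_polyB4 hd he) ?_
  intro σ h1 h2 h3
  rw [hS, Finset.map_singleton, Equiv.coe_toEmbedding, h2]
  ext i
  simp only [Finset.mem_compl, mem_modelSupp, Finset.mem_singleton, Fin.ext_iff]
  omega

theorem IsCircuit.unimodEquiv_polyA42 {d : ℕ} {P : Set (Fin d → ℝ)} {v : Fin (d + 1) → Fin d → ℝ}
    {S : Finset (Fin (d + 1))} {a b c : Fin (d + 1)} (H : IsCircuit P v S a b c) (hd : 4 ≤ d)
    (he : Even (d + 1 - 2)) (hS : Sᶜ = {a, b}) : UnimodEquiv P (polyA42 d) := by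
  refine H.unimodEquiv_of_compl (isCircuit_polyA42 hd he) ?_
  intro σ h1 h2 h3
  rw [hS, Finset.map_insert, Finset.map_singleton, Equiv.coe_toEmbedding, h1, h2]
  ext i
  simp only [Finset.mem_compl, mem_modelSupp, Finset.mem_insert, Finset.mem_singleton, Fin.ext_iff]
  omega

theorem IsCircuit.unimodEquiv_polyA43 {d : ℕ} {P : Set (Fin d → ℝ)} {v : Fin (d + 1) → Fin d → ℝ}
    {S : Finset (Fin (d + 1))} {a b c : Fin (d + 1)} (H : IsCircuit P v S a b c) (hd : 4 ≤ d)
    (he : Even (d + 1 - 3)) (hS : Sᶜ = {a, b, c}) : UnimodEquiv P (polyA43 d) := by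
  refine H.unimodEquiv_of_compl (isCircuit_polyA43 hd he) ?_
  intro σ h1 h2 h3
  rw [hS, Finset.map_insert, Finset.map_insert, Finset.map_singleton, Equiv.coe_toEmbedding, h1, h2,
    h3]
  ext i
  simp only [Finset.mem_compl, mem_modelSupp, Finset.mem_insert, Finset.mem_singleton, Fin.ext_iff]
  omega

theorem mem_shiftedPts {d : ℕ} {s : Fin (d + 1) → ℝ} {m n : ℕ} (hs : ∑ i, s i = m)
    {x : Fin (d + 1) → ℝ} : x ∈ shiftedPts s m n ↔
      ∑ i, x i = n ∧ ∀ i, s i ≤ x i ∧ x i - s i ∈ intSubring := by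
  constructor
  · intro hx
    refine ⟨sum_of_mem_shiftedPts hs hx, ?_⟩
    obtain ⟨b, -, rfl⟩ := hx
    exact fun i => ⟨by simp, by simp⟩
  · rintro ⟨hsum, hx⟩
    choose b hb using fun i => natCast_of_mem_intSubring (hx i).2 (sub_nonneg.2 (hx i).1)
    refine ⟨b, ?_, funext fun i => by simp [← hb]⟩
    rw [Set.mem_ofPred_eq]
    have : (m : ℝ) + ∑ i, (b i : ℝ) = n := by
      rw [← hs, ← Finset.sum_add_distrib, ← hsum]
      exact Finset.sum_congr rfl fun i _ => by rw [← hb]; ring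
    exact_mod_cast this

theorem le_of_sub_mem_intSubring {x s : ℝ} (h : x - s ∈ intSubring) (h1 : -1 < x - s) : s ≤ x := by
  obtain ⟨z, hz⟩ := mem_intSubring.1 h
  rw [hz] at h1
  have h2 : -1 < z := by exact_mod_cast h1
  have h3 : (0 : ℝ) ≤ z := by exact_mod_cast (by omega : 0 ≤ z)
  linarith

/-- Coefficient vectors, with respect to the vertices of the simplex, of the points in the cone over
the polytope at height `n`. -/
def circuitCone {d : ℕ} (a b c : Fin (d + 1)) (n : ℕ) : Set (Fin (d + 1) → ℝ) :=
  {α | ∑ i, α i = n ∧ (∀ i, i ≠ c → 0 ≤ α i) ∧ 0 ≤ α a + α c ∧ 0 ≤ α b + α c}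

/-- The change of coefficients when `v c` is exchanged with the opposite vertex of the
parallelogram. -/
def flipCoeff {d : ℕ} (a b c : Fin (d + 1)) (α : Fin (d + 1) → ℝ) (i : Fin (d + 1)) : ℝ :=
  α i + α c * (Pi.single a 1 + Pi.single b 1 - Pi.single c 1 - Pi.single c 1 : Fin (d + 1) → ℝ) i

section flip

variable {d : ℕ} {a b c : Fin (d + 1)}

theorem flipCoeff_a (hab : a ≠ b) (hac : a ≠ c) (α : Fin (d + 1) → ℝ) :
    flipCoeff a b c α a = α a + α c := by
  simp [flipCoeff, hab, hac]

theorem flipCoeff_b (hab : a ≠ b) (hbc : b ≠ c) (α : Fin (d + 1) → ℝ) :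
    flipCoeff a b c α b = α b + α c := by
  simp [flipCoeff, hab.symm, hbc]

theorem flipCoeff_c (hac : a ≠ c) (hbc : b ≠ c) (α : Fin (d + 1) → ℝ) :
    flipCoeff a b c α c = -α c := by
  simp [flipCoeff, hac.symm, hbc.symm]
  ring

theorem flipCoeff_of_ne {i : Fin (d + 1)} (ha : i ≠ a) (hb : i ≠ b) (hc : i ≠ c)
    (α : Fin (d + 1) → ℝ) : flipCoeff a b c α i = α i := by
  simp [flipCoeff, ha, hb, hc]

theorem sum_flipCoeff (α : Fin (d + 1) → ℝ) : ∑ i, flipCoeff a b c α i = ∑ i, α i := by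
  simp [flipCoeff, Finset.sum_add_distrib, ← Finset.mul_sum]

theorem flipCoeff_flipCoeff (hac : a ≠ c) (hbc : b ≠ c) (α : Fin (d + 1) → ℝ) :
    flipCoeff a b c (flipCoeff a b c α) = α := by
  ext i
  rw [flipCoeff, flipCoeff_c hac hbc, flipCoeff]
  ring

theorem flipCoeff_sub (α β : Fin (d + 1) → ℝ) (i : Fin (d + 1)) :
    flipCoeff a b c α i - flipCoeff a b c β i = flipCoeff a b c (fun i => α i - β i) i := by
  simp only [flipCoeff]
  ring

theorem flipCoeff_mem_intSubring {α : Fin (d + 1) → ℝ} (h : ∀ i, α i ∈ intSubring)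
    (i : Fin (d + 1)) : flipCoeff a b c α i ∈ intSubring := by
  refine add_mem (h i) (mul_mem (h c) ?_)
  simp only [Pi.add_apply, Pi.sub_apply, Pi.single_apply]
  split_ifs <;> norm_num

theorem image_flipCoeff (hac : a ≠ c) (hbc : b ≠ c) (A : Set (Fin (d + 1) → ℝ)) :
    flipCoeff a b c '' A = {α | flipCoeff a b c α ∈ A} := by
  ext α
  constructor
  · rintro ⟨β, hβ, rfl⟩
    rwa [Set.mem_ofPred_eq, flipCoeff_flipCoeff hac hbc]
  · intro h
    exact ⟨_, h, flipCoeff_flipCoeff hac hbc α⟩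

theorem ncard_image_flipCoeff (hac : a ≠ c) (hbc : b ≠ c) (A : Set (Fin (d + 1) → ℝ)) :
    (flipCoeff a b c '' A).ncard = A.ncard :=
  Set.ncard_image_of_injective _
    (Function.LeftInverse.injective (flipCoeff_flipCoeff hac hbc))

theorem mem_circuitCone_iff_of_nonneg {n : ℕ} {α : Fin (d + 1) → ℝ} (hc : 0 ≤ α c) :
    α ∈ circuitCone a b c n ↔ ∑ i, α i = n ∧ ∀ i, 0 ≤ α i := by
  refine and_congr_right fun _ => ⟨fun h i => ?_, fun h => ?_⟩
  · by_cases hi : i = c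
    · rwa [hi]
    · exact h.1 i hi
  · exact ⟨fun i _ => h i, add_nonneg (h a) hc, add_nonneg (h b) hc⟩

theorem mem_circuitCone_iff_of_neg (hab : a ≠ b) (hac : a ≠ c) (hbc : b ≠ c) {n : ℕ}
    {α : Fin (d + 1) → ℝ} (hc : α c < 0) :
    α ∈ circuitCone a b c n ↔
      ∑ i, flipCoeff a b c α i = n ∧ ∀ i, 0 ≤ flipCoeff a b c α i := by
  rw [sum_flipCoeff]
  refine and_congr_right fun _ => ⟨fun h i => ?_, fun h => ⟨fun i hi => ?_, ?_, ?_⟩⟩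
  · by_cases h1 : i = a
    · rw [h1, flipCoeff_a hab hac]
      exact h.2.1
    by_cases h2 : i = b
    · rw [h2, flipCoeff_b hab hbc]
      exact h.2.2
    by_cases h3 : i = c
    · rw [h3, flipCoeff_c hac hbc]
      linarith
    · rw [flipCoeff_of_ne h1 h2 h3]
      exact h.1 i h3
  · by_cases h1 : i = a
    · have := h a
      rw [flipCoeff_a hab hac] at this
      rw [h1]
      linarith
    by_cases h2 : i = b
    · have := h b
      rw [flipCoeff_b hab hbc] at this
      rw [h2]
      linarith
    · have := h i
      rwa [flipCoeff_of_ne h1 h2 hi] at this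
  · rw [← flipCoeff_a hab hac]
    exact h a
  · rw [← flipCoeff_b hab hbc]
    exact h b

/-- The part of the cone with `0 ≤ α c` in a coset of the integers. -/
theorem circuitCone_nonneg_eq {n m : ℕ} {h s : Fin (d + 1) → ℝ} (hs : ∑ i, s i = m)
    (hs0 : ∀ i, 0 ≤ s i) (hs1 : ∀ i, s i < 1) (hh : ∀ i, h i - s i ∈ intSubring) :
    {α ∈ circuitCone a b c n | (∀ i, α i - h i ∈ intSubring) ∧ 0 ≤ α c} = shiftedPts s m n := by
  ext α
  rw [mem_shiftedPts hs]
  constructor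
  · rintro ⟨hα, hZ, hc⟩
    rw [mem_circuitCone_iff_of_nonneg hc] at hα
    have hZ' : ∀ i, α i - s i ∈ intSubring := fun i => by
      simpa using add_mem (hZ i) (hh i)
    exact ⟨hα.1, fun i => ⟨le_of_sub_mem_intSubring (hZ' i) (by linarith [hα.2 i, hs1 i]), hZ' i⟩⟩
  · rintro ⟨hsum, hα⟩
    have h0 : ∀ i, 0 ≤ α i := fun i => (hs0 i).trans (hα i).1
    refine ⟨(mem_circuitCone_iff_of_nonneg (h0 c)).2 ⟨hsum, h0⟩, fun i => ?_, h0 c⟩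
    simpa using sub_mem (hα i).2 (hh i)

/-- The part of the cone with `α c < 0` in a coset of the integers. -/
theorem circuitCone_neg_eq (hab : a ≠ b) (hac : a ≠ c) (hbc : b ≠ c) {n m : ℕ}
    {h s : Fin (d + 1) → ℝ} (hs : ∑ i, s i = m) (hs0 : ∀ i, 0 ≤ s i) (hsc : 0 < s c)
    (hs1 : ∀ i, i ≠ c → s i < 1) (hsc1 : s c ≤ 1)
    (hh : ∀ i, flipCoeff a b c h i - s i ∈ intSubring) :
    {α ∈ circuitCone a b c n | (∀ i, α i - h i ∈ intSubring) ∧ α c < 0} =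
      flipCoeff a b c '' shiftedPts s m n := by
  rw [image_flipCoeff hac hbc]
  ext α
  rw [Set.mem_ofPred_eq, Set.mem_ofPred_eq, mem_shiftedPts hs]
  constructor
  · rintro ⟨hα, hZ, hc⟩
    rw [mem_circuitCone_iff_of_neg hab hac hbc hc] at hα
    have hZ' : ∀ i, flipCoeff a b c α i - s i ∈ intSubring := fun i => by
      have := flipCoeff_mem_intSubring (a := a) (b := b) (c := c) hZ i
      rw [← flipCoeff_sub] at this
      simpa using add_mem this (hh i)
    refine ⟨hα.1, fun i => ⟨le_of_sub_mem_intSubring (hZ' i) ?_, hZ' i⟩⟩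
    by_cases hi : i = c
    · rw [hi, flipCoeff_c hac hbc]
      linarith
    · linarith [hα.2 i, hs1 i hi]
  · rintro ⟨hsum, hα⟩
    have h0 : ∀ i, 0 ≤ flipCoeff a b c α i := fun i => (hs0 i).trans (hα i).1
    have hc : α c < 0 := by
      have := (hα c).1
      rw [flipCoeff_c hac hbc] at this
      linarith
    refine ⟨(mem_circuitCone_iff_of_neg hab hac hbc hc).2 ⟨hsum, h0⟩, ?_, hc⟩
    have : ∀ i, flipCoeff a b c α i - flipCoeff a b c h i ∈ intSubring := fun i => by
      simpa using sub_mem (hα i).2 (hh i)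
    intro i
    have := flipCoeff_mem_intSubring (a := a) (b := b) (c := c) this i
    rwa [← flipCoeff_sub, flipCoeff_flipCoeff hac hbc, flipCoeff_flipCoeff hac hbc] at this

end flip

/-- Lattice points of a dilate correspond to the admissible coefficient vectors. -/
theorem IsCircuit.ehrhartCount_eq {d : ℕ} {P : Set (Fin d → ℝ)} {v : Fin (d + 1) → Fin d → ℝ}
    {S : Finset (Fin (d + 1))} {a b c : Fin (d + 1)} (H : IsCircuit P v S a b c) {n : ℕ}
    (hn : 0 < n) :
    ehrhartCount P n = {α ∈ circuitCone a b c n |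
      (∀ i, α i ∈ intSubring) ∨ ∀ i, α i - halfInd S i ∈ intSubring}.ncard := by
  have hP : P = convexHull ℝ (Set.range fun o : Option (Fin (d + 1)) =>
      o.elim (v a + v b - v c) v) := by
    rw [H.eq]
    congr 1
    ext x
    simp [Option.exists, eq_comm]
  have hinj : Set.InjOn (fun (α : Fin (d + 1) → ℝ) (j : Fin d) => ∑ i, α i * v i j)
      {α ∈ circuitCone a b c n |
        (∀ i, α i ∈ intSubring) ∨ ∀ i, α i - halfInd S i ∈ intSubring} := by
    intro α hα β hβ h
    refine eq_of_vecMul_eq H.lat.det_ne_zero fun j => ?_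
    simp only [homMat_apply]
    refine Fin.lastCases ?_ (fun j => ?_) j
    · simpa using hα.1.1.trans hβ.1.1.symm
    · simpa using congrFun h j
  rw [← hinj.ncard_image, ehrhartCount]
  congr 1
  have hlat : ∀ α : Fin (d + 1) → ℝ, ∑ i, α i = n →
      ((fun j => ∑ i, α i * v i j) ∈ latticePts d ↔
        (∀ i, α i ∈ intSubring) ∨ ∀ i, α i - halfInd S i ∈ intSubring) := by
    intro α hα
    rw [← H.lat α, Fin.forall_fin_succ', mem_latticePts]
    simp [hα]
  have hr : (0 : ℝ) < n := by exact_mod_cast hn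
  have hab := H.hab
  have hac := H.hac
  have hbc := H.hbc
  ext x
  rw [Set.mem_inter_iff, hP, mem_smul_convexHull_range hr]
  constructor
  · rintro ⟨hx, γ, h0, hsum, hγ⟩
    rw [Fintype.sum_option] at hsum
    have hx' : (fun j => ∑ i, (γ (some i) + γ none *
        (Pi.single a 1 + Pi.single b 1 - Pi.single c 1 : Fin (d + 1) → ℝ) i) * v i j) = x := by
      ext j
      rw [← hγ j, Fintype.sum_option]
      simp only [add_mul, Finset.sum_add_distrib, mul_assoc, ← Finset.mul_sum,
        (isBary_circuit v a b c).2 j, Option.elim]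
      ring
    have hsum' : ∑ i, (γ (some i) + γ none *
        (Pi.single a 1 + Pi.single b 1 - Pi.single c 1 : Fin (d + 1) → ℝ) i) = n := by
      rw [Finset.sum_add_distrib, ← Finset.mul_sum, (isBary_circuit v a b c).1]
      linarith
    refine ⟨_, ⟨⟨hsum', ?_, ?_, ?_⟩, (hlat _ hsum').1 (by rwa [hx'])⟩, hx'⟩
    · intro i hi
      refine add_nonneg (h0 _) (mul_nonneg (h0 _) ?_)
      rw [Pi.sub_apply, Pi.add_apply, Pi.single_eq_of_ne hi, Pi.single_apply, Pi.single_apply]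
      split_ifs <;> norm_num
    · simp [hab, hac, hac.symm, hbc.symm]
      linarith [h0 (some a), h0 (some c)]
    · simp [hab.symm, hbc, hac.symm, hbc.symm]
      linarith [h0 (some b), h0 (some c)]
  · rintro ⟨α, ⟨⟨hsum, hα, ha, hb⟩, hZ⟩, rfl⟩
    refine ⟨(hlat α hsum).2 hZ, fun o => o.elim (max 0 (-α c)) fun i => α i - max 0 (-α c) *
      (Pi.single a 1 + Pi.single b 1 - Pi.single c 1 : Fin (d + 1) → ℝ) i, ?_, ?_, ?_⟩
    · rintro (_ | i)
      · exact le_max_left _ _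
      simp only [Option.elim]
      by_cases h1 : i = a
      · have : max 0 (-α c) ≤ α a := max_le (hα a hac) (by linarith)
        simpa [h1, hab, hac] using this
      by_cases h2 : i = b
      · have : max 0 (-α c) ≤ α b := max_le (hα b hbc) (by linarith)
        simpa [h2, hab.symm, hbc] using this
      by_cases h3 : i = c
      · have := le_max_right 0 (-α c)
        simp [h3, hac.symm, hbc.symm]
        linarith
      · simpa [h1, h2, h3] using hα i h3
    · rw [Fintype.sum_option]
      simp only [Option.elim]
      rw [Finset.sum_sub_distrib, ← Finset.mul_sum, (isBary_circuit v a b c).1, hsum]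
      ring
    · intro j
      rw [Fintype.sum_option]
      simp only [Option.elim, sub_mul, Finset.sum_sub_distrib, mul_assoc, ← Finset.mul_sum,
        (isBary_circuit v a b c).2 j]
      ring

theorem IsCircuit.hasDeltaPoly {d : ℕ} {P : Set (Fin d → ℝ)} {v : Fin (d + 1) → Fin d → ℝ}
    {S : Finset (Fin (d + 1))} {a b c : Fin (d + 1)} (H : IsCircuit P v S a b c) (hS : S.Nonempty)
    {s : Fin (d + 1) → ℝ} {m m' : ℕ} (hm : S.card = 2 * m) (hs : ∑ i, s i = m')
    (hs0 : ∀ i, 0 ≤ s i) (hsc : 0 < s c) (hs1 : ∀ i, i ≠ c → s i < 1) (hsc1 : s c ≤ 1)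
    (hh : ∀ i, flipCoeff a b c (halfInd S) i - s i ∈ intSubring) :
    HasDeltaPoly P (1 + X + X ^ m + X ^ m') := by
  have hab := H.hab
  have hac := H.hac
  have hbc := H.hbc
  have hm0 : m ≠ 0 := by
    have := hS.card_pos
    omega
  have hm'0 : m' ≠ 0 := by
    rintro rfl
    rw [Nat.cast_zero, Finset.sum_eq_zero_iff_of_nonneg fun i _ => hs0 i] at hs
    exact hsc.ne' (hs c (Finset.mem_univ c))
  rw [hasDeltaPoly_iff]
  ext n
  simp only [Polynomial.coe_add, Polynomial.coe_one, Polynomial.coe_X, Polynomial.coe_pow, add_mul,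
    map_add]
  rw [ehrhartSeries, PowerSeries.coeff_mk]
  rcases Nat.eq_zero_or_pos n with rfl | hn
  · simp [hm0, hm'0]
  rw [if_neg hn.ne', H.ehrhartCount_eq hn]
  have e1 := circuitCone_nonneg_eq (a := a) (b := b) (c := c) (n := n) (m := 0) (h := 0) (s := 0)
    (by simp) (by simp) (by simp) (by simp)
  have e2 := circuitCone_neg_eq hab hac hbc (n := n) (m := 1) (h := 0) (s := Pi.single c 1)
    (by simp) (fun i => by rw [Pi.single_apply]; split_ifs <;> norm_num) (by simp)
    (fun i hi => by simp [hi]) (by simp)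
    (fun i => by simp only [flipCoeff, Pi.single_apply]; split_ifs <;> simp)
  have e3 := circuitCone_nonneg_eq (a := a) (b := b) (c := c) (n := n) (m := m) (h := halfInd S)
    (s := halfInd S) (by rw [sum_halfInd, hm]; push_cast; ring) (halfInd_nonneg S)
    (halfInd_lt_one S) (by simp)
  have e4 := circuitCone_neg_eq hab hac hbc (n := n) hs hs0 hsc hs1 hsc1 hh
  simp only [Pi.zero_apply, sub_zero] at e1 e2
  have hunion : {α ∈ circuitCone a b c n |
      (∀ i, α i ∈ intSubring) ∨ ∀ i, α i - halfInd S i ∈ intSubring} =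
      (shiftedPts 0 0 n ∪ flipCoeff a b c '' shiftedPts (Pi.single c 1) 1 n) ∪
      (shiftedPts (halfInd S) m n ∪ flipCoeff a b c '' shiftedPts s m' n) := by
    rw [← e1, ← e2, ← e3, ← e4]
    ext α
    have := lt_or_ge (α c) 0
    simp only [Set.mem_ofPred_eq, Set.mem_union]
    tauto
  obtain ⟨i₀, hi₀⟩ := hS
  have hnot : ∀ α : Fin (d + 1) → ℝ, (∀ i, α i ∈ intSubring) →
      ¬∀ i, α i - halfInd S i ∈ intSubring := by
    intro α h1 h2
    have := sub_mem (h1 i₀) (h2 i₀)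
    rw [sub_sub_cancel, halfInd_mem_iff] at this
    exact this hi₀
  have f1 := finite_shiftedPts (d := d) 0 0 n
  have f2 := (finite_shiftedPts (d := d) (Pi.single c 1) 1 n).image (flipCoeff a b c)
  have f3 := finite_shiftedPts (d := d) (halfInd S) m n
  have f4 := (finite_shiftedPts (d := d) s m' n).image (flipCoeff a b c)
  have d12 : Disjoint (shiftedPts 0 0 n) (flipCoeff a b c '' shiftedPts (Pi.single c 1) 1 n) := by
    rw [← e1, ← e2, Set.disjoint_left]
    exact fun α h h' => h.2.2.not_gt h'.2.2
  have d34 : Disjoint (shiftedPts (halfInd S) m n) (flipCoeff a b c '' shiftedPts s m' n) := by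
    rw [← e3, ← e4, Set.disjoint_left]
    exact fun α h h' => h.2.2.not_gt h'.2.2
  have d1234 : Disjoint
      (shiftedPts 0 0 n ∪ flipCoeff a b c '' shiftedPts (Pi.single c 1) 1 n)
      (shiftedPts (halfInd S) m n ∪ flipCoeff a b c '' shiftedPts s m' n) := by
    rw [← e1, ← e2, ← e3, ← e4, Set.disjoint_left]
    rintro α (h | h) (h' | h') <;> exact hnot α h.2.1 h'.2.1
  rw [hunion, Set.ncard_union_eq d1234 (f1.union f2) (f3.union f4), Set.ncard_union_eq d12 f1 f2,
    Set.ncard_union_eq d34 f3 f4, ncard_image_flipCoeff hac hbc, ncard_image_flipCoeff hac hbc]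
  push_cast
  rw [ncard_shiftedPts, ncard_shiftedPts, ncard_shiftedPts, ncard_shiftedPts]
  simp only [pow_zero, pow_one, one_mul]
  ring

section delta

variable {d : ℕ} {P : Set (Fin d → ℝ)} {v : Fin (d + 1) → Fin d → ℝ} {S : Finset (Fin (d + 1))}
  {a b c : Fin (d + 1)} {m : ℕ}

theorem IsCircuit.hasDeltaPoly_of_notMem (H : IsCircuit P v S a b c) (hS : S.Nonempty)
    (hm : S.card = 2 * m) (hc : c ∉ S) : HasDeltaPoly P (1 + X + X ^ m + X ^ (m + 1)) := by
  have hc0 : halfInd S c = 0 := if_neg hc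
  refine H.hasDeltaPoly hS (s := halfInd S + Pi.single c 1) hm ?_ (fun i => ?_) ?_ (fun i hi => ?_)
    ?_ fun i => ?_
  · simp only [Pi.add_apply, Finset.sum_add_distrib, sum_halfInd, hm]
    simp
  · refine add_nonneg (halfInd_nonneg S i) ?_
    rw [Pi.single_apply]
    split_ifs <;> norm_num
  · simp [hc0]
  · simpa [hi] using halfInd_lt_one S i
  · simp [hc0]
  · rw [flipCoeff, hc0, Pi.add_apply, Pi.single_apply]
    split_ifs <;> simp

theorem IsCircuit.hasDeltaPoly_of_mem (H : IsCircuit P v S a b c) (hm : S.card = 2 * m)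
    (hc : c ∈ S) (ha : a ∉ S) (hb : b ∉ S) : HasDeltaPoly P (1 + X + X ^ m + X ^ (m + 1)) := by
  have hab := H.hab
  have hac := H.hac
  have hbc := H.hbc
  refine H.hasDeltaPoly ⟨c, hc⟩ (s := halfInd (insert a (insert b S))) hm ?_
    (halfInd_nonneg _) ?_ (fun i _ => halfInd_lt_one _ i) (halfInd_lt_one _ _).le fun i => ?_
  · rw [sum_halfInd, Finset.card_insert_of_notMem (by simp [hab, ha]),
      Finset.card_insert_of_notMem hb, hm]
    push_cast
    ring
  · simp [halfInd, hc]
  · by_cases h1 : i = a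
    · rw [h1, flipCoeff_a hab hac]
      simp [halfInd, ha, hc]
    by_cases h2 : i = b
    · rw [h2, flipCoeff_b hab hbc]
      simp [halfInd, hb, hc]
    by_cases h3 : i = c
    · rw [h3, flipCoeff_c hac hbc]
      simp [halfInd, hc]
      norm_num
      exact ⟨-1, by norm_num⟩
    · rw [flipCoeff_of_ne h1 h2 h3]
      simp [halfInd, h1, h2]

theorem IsCircuit.hasDeltaPoly_of_mem_of_mem (H : IsCircuit P v S a b c) (hm : S.card = 2 * m)
    (hc : c ∈ S) (ha : a ∈ S) (hb : b ∉ S) : HasDeltaPoly P (1 + X + C 2 * X ^ m) := by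
  have hab := H.hab
  have hac := H.hac
  have hbc := H.hbc
  have := H.hasDeltaPoly ⟨c, hc⟩ (s := halfInd (insert b (S.erase a))) (m' := m) hm ?_
    (halfInd_nonneg _) ?_ (fun i _ => halfInd_lt_one _ i) (halfInd_lt_one _ _).le fun i => ?_
  · convert this using 1
    rw [show (C 2 : ℤ[X]) = 2 from rfl]
    ring
  · have := Finset.card_pos.2 ⟨a, ha⟩
    rw [sum_halfInd, Finset.card_insert_of_notMem (by simp [hb]), Finset.card_erase_of_mem ha,
      Nat.sub_add_cancel this, hm]
    push_cast
    ring
  · simp [halfInd, hc, hac.symm]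
  · by_cases h1 : i = a
    · rw [h1, flipCoeff_a hab hac]
      simp [halfInd, ha, hc, hab]
      norm_num
    by_cases h2 : i = b
    · rw [h2, flipCoeff_b hab hbc]
      simp [halfInd, hb, hc]
    by_cases h3 : i = c
    · rw [h3, flipCoeff_c hac hbc]
      simp [halfInd, hc, hac.symm]
      norm_num
      exact ⟨-1, by norm_num⟩
    · rw [flipCoeff_of_ne h1 h2 h3]
      simp [halfInd, h1, h2]

end delta

theorem HasDeltaPoly.eq {d : ℕ} {P : Set (Fin d → ℝ)} {p q : Polynomial ℤ} (hp : HasDeltaPoly P p)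
    (hq : HasDeltaPoly P q) : p = q := by
  rw [HasDeltaPoly] at hp hq
  exact Polynomial.coe_injective ℤ (hp.symm.trans hq)

theorem deltaPoly_ne (k : ℕ) :
    (1 + X + X ^ k + X ^ (k + 1) : ℤ[X]) ≠ 1 + X + C 2 * X ^ k := by
  intro h
  have := congrArg (fun p => p.coeff (k + 1)) h
  simp [coeff_X, coeff_one, coeff_X_pow] at this

/-- classification of non-simplex lattice polytopes of normalized volume at
most 4 whose lattice points do not span `ℤ^{d+1}`, up to unimodular equivalence and
lattice pyramids. -/
theorem nonspanning_classification {d : ℕ} (P : Set (Fin d → ℝ))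
    (hP : IsLatticePolytope P) (hdim : affineSpan ℝ P = ⊤) (hns : ¬ IsSimplex P)
    (hvol : ∃ p : Polynomial ℤ, HasDeltaPoly P p ∧ 2 ≤ p.eval 1 ∧ p.eval 1 ≤ 4)
    (hspan : ¬ SpansLattice P) (hpyr : ¬ IsLatticePyramid P) :
    ∃ k : ℕ, 2 ≤ k ∧
      (let C1 := d = 2 * k ∧ HasDeltaPoly P (1 + X + X ^ k + X ^ (k + 1)) ∧
        UnimodEquiv P (polyA41 d)
      let C2 := d = 2 * k + 1 ∧ HasDeltaPoly P (1 + X + X ^ k + X ^ (k + 1)) ∧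
        UnimodEquiv P (polyA42 d)
      let C3 := d = 2 * k + 2 ∧ HasDeltaPoly P (1 + X + X ^ k + X ^ (k + 1)) ∧
        UnimodEquiv P (polyA43 d)
      let C4 := d = 2 * k ∧ HasDeltaPoly P (1 + X + Polynomial.C 2 * X ^ k) ∧
        UnimodEquiv P (polyB4 d)
      (C1 ∨ C2 ∨ C3 ∨ C4) ∧ ¬(C1 ∧ C2) ∧ ¬(C1 ∧ C3) ∧ ¬(C1 ∧ C4) ∧
        ¬(C2 ∧ C3) ∧ ¬(C2 ∧ C4) ∧ ¬(C3 ∧ C4)) := by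
  obtain ⟨p, hp, -, hp4⟩ := hvol
  obtain ⟨_, _, _, _, _, H, hS⟩ := exists_isCircuit hP hdim hns hp hp4 hspan
  obtain ⟨v, S, a, b, c, H, hcard, hcases⟩ := H.exists_normal_form hS hspan hpyr
  have hS : S.Nonempty := Finset.card_pos.1 (by omega)
  obtain ⟨k, hk⟩ := H.lat.even_card
  rw [← two_mul] at hk
  have hk2 : 2 ≤ k := by omega
  have hcompl := Finset.card_compl_add_card S
  rw [Fintype.card_fin] at hcompl
  have hmem : ∀ i, i ∈ S ↔ i ∉ Sᶜ := by simp
  have hab := H.hab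
  have hac := H.hac
  have hbc := H.hbc
  refine ⟨k, hk2, ?_, fun h => ?_, fun h => ?_, fun h => ?_, fun h => ?_, fun h => ?_, fun h => ?_⟩
  · rcases hcases with h | h | h | h
    · rw [h, Finset.card_singleton] at hcompl
      have hd : d = 2 * k := by omega
      exact Or.inl ⟨hd, H.hasDeltaPoly_of_notMem hS hk (by simp [hmem, h]),
        H.unimodEquiv_polyA41 (by omega) ⟨k, by omega⟩ h⟩
    · rw [h, Finset.card_singleton] at hcompl
      have hd : d = 2 * k := by omega
      exact Or.inr (Or.inr (Or.inr ⟨hd, H.hasDeltaPoly_of_mem_of_mem hk (by simp [hmem, h, hbc.symm])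
        (by simp [hmem, h, hab]) (by simp [hmem, h]),
        H.unimodEquiv_polyB4 (by omega) ⟨k, by omega⟩ h⟩))
    · rw [h, Finset.card_pair hab] at hcompl
      have hd : d = 2 * k + 1 := by omega
      exact Or.inr (Or.inl ⟨hd, H.hasDeltaPoly_of_mem hk (by simp [hmem, h, hbc.symm, hac.symm])
        (by simp [hmem, h]) (by simp [hmem, h]),
        H.unimodEquiv_polyA42 (by omega) ⟨k, by omega⟩ h⟩)
    · rw [h, Finset.card_eq_three.2 ⟨a, b, c, hab, hac, hbc, rfl⟩] at hcompl
      have hd : d = 2 * k + 2 := by omega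
      exact Or.inr (Or.inr (Or.inl ⟨hd, H.hasDeltaPoly_of_notMem hS hk (by simp [hmem, h]),
        H.unimodEquiv_polyA43 (by omega) ⟨k, by omega⟩ h⟩))
  · have := h.1.1
    have := h.2.1
    omega
  · have := h.1.1
    have := h.2.1
    omega
  · exact deltaPoly_ne k (h.1.2.1.eq h.2.2.1)
  · have := h.1.1
    have := h.2.1
    omega
  · have := h.1.1
    have := h.2.1
    omega
  · have := h.1.1
    have := h.2.1
    omega
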